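/- Let n ≥ 3, let F be a Finsler metric on an open set U ⊆ ℝⁿ of sectional flag curvature, and fix x ∈ U. If the set of polar directions at x has positive Lebesgue measure in ℝⁿ, then the flag curvature is isotropic at x. If the set of polar directions at x has Lebesgue measure zero, then the Minkowski norm F(x,·) is a Randers norm: there exist a symmetric positive definite matrix (a_{ij}) and a covector (b_i) with a^{ij}b_ib_j < 1 such that F(x, y) = √(a_{ij}y^iy^j) + b_iy^i for all y ≠ 0. -/

import Mathlib

open scoped BigOperators
open MeasureTheory

noncomputable section

namespace Paper

/-- `E n` is the model space ℝⁿ. -/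
abbrev E (n : ℕ) := Fin n → ℝ

/-- `e n i` is the `i`-th standard basis vector of ℝⁿ. -/
def e (n : ℕ) (i : Fin n) : E n := Pi.single i 1

/-- Partial derivative of `f(x,y)` in the fiber variable `y^i`. -/
def pdy (n : ℕ) (f : E n → E n → ℝ) (i : Fin n) : E n → E n → ℝ :=
  fun x y => fderiv ℝ (f x) y (e n i)

/-- Partial derivative of `f(x,y)` in the base variable `x^k`. -/
def pdx (n : ℕ) (f : E n → E n → ℝ) (k : Fin n) : E n → E n → ℝ :=
  fun x y => fderiv ℝ (fun x' => f x' y) x (e n k)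

/-- The square `F²` of the metric. -/
def F2 (n : ℕ) (F : E n → E n → ℝ) : E n → E n → ℝ := fun x y => (F x y) ^ 2

/-- Fundamental tensor `g_{ij} = ½ [F²]_{y^i y^j}`. -/
def gm (n : ℕ) (F : E n → E n → ℝ) (i j : Fin n) : E n → E n → ℝ :=
  fun x y => (1 / 2 : ℝ) * pdy n (pdy n (F2 n F) j) i x y

/-- The fundamental tensor as a matrix. -/
def gmat (n : ℕ) (F : E n → E n → ℝ) (x y : E n) : Matrix (Fin n) (Fin n) ℝ :=
  Matrix.of fun i j => gm n F i j x y

/-- The inverse fundamental tensor `g^{ij}`. -/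
def ginv (n : ℕ) (F : E n → E n → ℝ) (x y : E n) : Matrix (Fin n) (Fin n) ℝ :=
  (gmat n F x y)⁻¹

/-- `F_{y^i}`. -/
def Fy (n : ℕ) (F : E n → E n → ℝ) (i : Fin n) : E n → E n → ℝ := pdy n F i

/-- Angular metric `h_{ij} = g_{ij} - F_{y^i} F_{y^j}`. -/
def hm (n : ℕ) (F : E n → E n → ℝ) (i j : Fin n) : E n → E n → ℝ :=
  fun x y => gm n F i j x y - Fy n F i x y * Fy n F j x y

/-- Cartan tensor `C_{ijk} = ¼ [F²]_{y^i y^j y^k}`. -/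
def Cartan (n : ℕ) (F : E n → E n → ℝ) (i j k : Fin n) : E n → E n → ℝ :=
  fun x y => (1 / 4 : ℝ) * pdy n (pdy n (pdy n (F2 n F) k) j) i x y

/-- Mean Cartan tensor `I_i = g^{jk} C_{ijk}`. -/
def meanCartan (n : ℕ) (F : E n → E n → ℝ) (i : Fin n) : E n → E n → ℝ :=
  fun x y => ∑ j, ∑ k, ginv n F x y j k * Cartan n F i j k x y

/-- Matsumoto torsion `M_{ijk}`. -/
def Matsumoto (n : ℕ) (F : E n → E n → ℝ) (i j k : Fin n) : E n → E n → ℝ :=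
  fun x y => Cartan n F i j k x y -
    (1 / ((n : ℝ) + 1)) * (hm n F i j x y * meanCartan n F k x y +
      hm n F j k x y * meanCartan n F i x y + hm n F k i x y * meanCartan n F j x y)

/-- Spray coefficients `G^i = ¼ g^{il} ([F²]_{x^k y^l} y^k - [F²]_{x^l})`. -/
def Spray (n : ℕ) (F : E n → E n → ℝ) (i : Fin n) : E n → E n → ℝ :=
  fun x y => (1 / 4 : ℝ) * ∑ l, ginv n F x y i l *
    ((∑ k, pdx n (pdy n (F2 n F) l) k x y * y k) - pdx n (F2 n F) l x y)

/-- Riemann curvature `R^i_k`. -/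
def RiemUp (n : ℕ) (F : E n → E n → ℝ) (i k : Fin n) : E n → E n → ℝ :=
  fun x y =>
    2 * pdx n (Spray n F i) k x y
    - (∑ j, y j * pdx n (pdy n (Spray n F i) k) j x y)
    + 2 * (∑ j, Spray n F j x y * pdy n (pdy n (Spray n F i) k) j x y)
    - ∑ j, pdy n (Spray n F i) j x y * pdy n (Spray n F j) k x y

/-- Riemann curvature with lowered index `R_{jk} = g_{ij} R^i_k`. -/
def Rlow (n : ℕ) (F : E n → E n → ℝ) (j k : Fin n) : E n → E n → ℝ :=
  fun x y => ∑ i, gm n F i j x y * RiemUp n F i k x y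

/-- Flag curvature `K(x,y,v)`. -/
def K (n : ℕ) (F : E n → E n → ℝ) (x y v : E n) : ℝ :=
  (∑ j, ∑ k, Rlow n F j k x y * v j * v k) /
    ((F x y) ^ 2 * ∑ j, ∑ k, hm n F j k x y * v j * v k)

/-- `F` is a Finsler metric on the open set `U ⊆ ℝⁿ`. -/
structure IsFinsler (n : ℕ) (U : Set (E n)) (F : E n → E n → ℝ) : Prop where
  smooth : ContDiffOn ℝ (⊤ : ℕ∞) (fun p : E n × E n => F p.1 p.2) (U ×ˢ {y : E n | y ≠ 0})
  pos : ∀ x ∈ U, ∀ y : E n, y ≠ 0 → 0 < F x y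
  homog : ∀ x ∈ U, ∀ y : E n, y ≠ 0 → ∀ c : ℝ, 0 < c → F x (c • y) = c * F x y
  posdef : ∀ x ∈ U, ∀ y : E n, y ≠ 0 → (gmat n F x y).PosDef

/-- `F` is of sectional flag curvature: `K` only depends on the section. -/
def SectionalFlagCurv (n : ℕ) (U : Set (E n)) (F : E n → E n → ℝ) : Prop :=
  ∀ x ∈ U, ∀ y v y' v' : E n,
    LinearIndependent ℝ ![y, v] → LinearIndependent ℝ ![y', v'] →
    Submodule.span ℝ {y, v} = Submodule.span ℝ {y', v'} →
    K n F x y v = K n F x y' v'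

/-- The flag curvature is isotropic at `x`. -/
def IsotropicAt (n : ℕ) (F : E n → E n → ℝ) (x : E n) : Prop :=
  ∃ c : ℝ, ∀ y v : E n, LinearIndependent ℝ ![y, v] → K n F x y v = c

/-- The spray vector field `G = y^i ∂/∂x^i - 2G^i ∂/∂y^i` acting on a function of `(x,y)`. -/
def Gop (n : ℕ) (F f : E n → E n → ℝ) : E n → E n → ℝ :=
  fun x y => (∑ i, y i * pdx n f i x y) - 2 * ∑ i, Spray n F i x y * pdy n f i x y

/-- Dynamical derivative of a 1-index tensor. -/
def Dyn1 (n : ℕ) (F : E n → E n → ℝ) (T : Fin n → E n → E n → ℝ) (i : Fin n) :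
    E n → E n → ℝ :=
  fun x y => Gop n F (T i) x y - ∑ m, pdy n (Spray n F m) i x y * T m x y

/-- Dynamical derivative of a 2-index tensor. -/
def Dyn2 (n : ℕ) (F : E n → E n → ℝ) (T : Fin n → Fin n → E n → E n → ℝ) (i j : Fin n) :
    E n → E n → ℝ :=
  fun x y => Gop n F (T i j) x y - (∑ m, pdy n (Spray n F m) i x y * T m j x y)
    - ∑ m, pdy n (Spray n F m) j x y * T i m x y

/-- Dynamical derivative of a 3-index tensor. -/
def Dyn3 (n : ℕ) (F : E n → E n → ℝ) (T : Fin n → Fin n → Fin n → E n → E n → ℝ)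
    (i j k : Fin n) : E n → E n → ℝ :=
  fun x y => Gop n F (T i j k) x y - (∑ m, pdy n (Spray n F m) i x y * T m j k x y)
    - (∑ m, pdy n (Spray n F m) j x y * T i m k x y)
    - ∑ m, pdy n (Spray n F m) k x y * T i j m x y

/-- `y` is a polar direction at `x`: `R_{jk} = κ F² h_{jk}` for some constant `κ`. -/
def IsPolarDir (n : ℕ) (F : E n → E n → ℝ) (x y : E n) : Prop :=
  ∃ κ : ℝ, ∀ j k : Fin n, Rlow n F j k x y = κ * (F x y) ^ 2 * hm n F j k x y

section Proof
open scoped ContDiff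
/-! ### Directional derivatives of smooth functions on open sets -/

section Calculus
variable {V : Type*} [NormedAddCommGroup V] [NormedSpace ℝ V]

/-- Directional derivative. -/
def D (v : V) (f : V → ℝ) : V → ℝ := fun y => fderiv ℝ f y v

/-- Smooth on a set. -/
def Sm (Ω : Set V) (f : V → ℝ) : Prop := ContDiffOn ℝ ∞ f Ω

variable {Ω : Set V} {f g : V → ℝ} {y : V}

lemma Sm.at (hf : Sm Ω f) (hΩ : IsOpen Ω) (hy : y ∈ Ω) : ContDiffAt ℝ ∞ f y :=
  ContDiffOn.contDiffAt hf (hΩ.mem_nhds hy)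

lemma Sm.diffAt (hf : Sm Ω f) (hΩ : IsOpen Ω) (hy : y ∈ Ω) : DifferentiableAt ℝ f y :=
  (hf.at hΩ hy).differentiableAt (by simp)

lemma Sm.D (hf : Sm Ω f) (hΩ : IsOpen Ω) (v : V) : Sm Ω (D v f) := by
  have h : ContDiffOn ℝ ∞ (fderiv ℝ f) Ω := ContDiffOn.fderiv_of_isOpen hf hΩ (by simp)
  exact h.clm_apply contDiffOn_const

lemma Sm.congr (hf : Sm Ω f) (h : ∀ y ∈ Ω, g y = f y) : Sm Ω g := ContDiffOn.congr hf h

lemma Sm.add (hf : Sm Ω f) (hg : Sm Ω g) : Sm Ω (fun y => f y + g y) := ContDiffOn.add hf hg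
lemma Sm.sub (hf : Sm Ω f) (hg : Sm Ω g) : Sm Ω (fun y => f y - g y) := ContDiffOn.sub hf hg
lemma Sm.mul (hf : Sm Ω f) (hg : Sm Ω g) : Sm Ω (fun y => f y * g y) := ContDiffOn.mul hf hg
lemma Sm.neg (hf : Sm Ω f) : Sm Ω (fun y => - f y) := ContDiffOn.neg hf
lemma Sm.const (c : ℝ) : Sm Ω (fun _ => c) := contDiffOn_const
lemma Sm.sum {ι : Type*} {s : Finset ι} {F : ι → V → ℝ} (h : ∀ i ∈ s, Sm Ω (F i)) :
    Sm Ω (fun y => ∑ i ∈ s, F i y) := ContDiffOn.sum h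
lemma Sm.prod {ι : Type*} {s : Finset ι} {F : ι → V → ℝ} (h : ∀ i ∈ s, Sm Ω (F i)) :
    Sm Ω (fun y => ∏ i ∈ s, F i y) := contDiffOn_prod h
lemma Sm.inv (hf : Sm Ω f) (h0 : ∀ y ∈ Ω, f y ≠ 0) : Sm Ω (fun y => (f y)⁻¹) :=
  ContDiffOn.inv hf h0
lemma Sm.mono {Ω' : Set V} (hf : Sm Ω f) (h : Ω' ⊆ Ω) : Sm Ω' f := ContDiffOn.mono hf h

lemma D_comm (hf : Sm Ω f) (hΩ : IsOpen Ω) (hy : y ∈ Ω) (u v : V) :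
    D u (D v f) y = D v (D u f) y := by
  have h := (hf.at hΩ hy).isSymmSndFDerivAt
    (by simpa using (WithTop.coe_le_coe.2 le_top : ((2 : ℕ∞) : WithTop ℕ∞) ≤ ∞))
  have h2 : DifferentiableAt ℝ (fderiv ℝ f) y := by
    have h : ContDiffOn ℝ ∞ (fderiv ℝ f) Ω := ContDiffOn.fderiv_of_isOpen hf hΩ (by simp)
    exact (h.contDiffAt (hΩ.mem_nhds hy)).differentiableAt (by simp)
  have key : ∀ u v : V, D u (D v f) y = fderiv ℝ (fderiv ℝ f) y u v := by
    intro u v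
    unfold Paper.D
    rw [fderiv_clm_apply h2 (differentiableAt_const v)]
    simp
  rw [key, key]
  exact h u v

lemma D_congr (hΩ : IsOpen Ω) (hy : y ∈ Ω) (h : ∀ z ∈ Ω, f z = g z) (v : V) :
    D v f y = D v g y := by
  unfold D
  rw [Filter.EventuallyEq.fderiv_eq]
  filter_upwards [hΩ.mem_nhds hy] with z hz using h z hz

lemma D_add (hf : DifferentiableAt ℝ f y) (hg : DifferentiableAt ℝ g y) (v : V) :
    D v (fun y => f y + g y) y = D v f y + D v g y := by
  unfold D; rw [fderiv_fun_add hf hg]; rfl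
lemma D_sub (hf : DifferentiableAt ℝ f y) (hg : DifferentiableAt ℝ g y) (v : V) :
    D v (fun y => f y - g y) y = D v f y - D v g y := by
  unfold D; rw [fderiv_fun_sub hf hg]; rfl
lemma D_mul (hf : DifferentiableAt ℝ f y) (hg : DifferentiableAt ℝ g y) (v : V) :
    D v (fun y => f y * g y) y = f y * D v g y + g y * D v f y := by
  unfold D; rw [fderiv_fun_mul hf hg]; simp
lemma D_const_mul (hf : DifferentiableAt ℝ f y) (c : ℝ) (v : V) :
    D v (fun y => c * f y) y = c * D v f y := by
  unfold D; rw [fderiv_const_mul hf]; simp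
lemma D_const (c : ℝ) (v : V) : D v (fun _ => c) y = 0 := by
  unfold D; simp
lemma D_inv (hf : DifferentiableAt ℝ f y) (h0 : f y ≠ 0) (v : V) :
    D v (fun y => (f y)⁻¹) y = - D v f y / (f y)^2 := by
  have h := (hasDerivAt_inv h0).comp_hasFDerivAt y hf.hasFDerivAt
  unfold D
  have h4 : (fun y => (f y)⁻¹) = (fun y : ℝ => y⁻¹) ∘ f := rfl
  rw [h4, h.fderiv]
  simp; field_simp
lemma D_sum {ι : Type*} {s : Finset ι} {F : ι → V → ℝ}
    (h : ∀ i ∈ s, DifferentiableAt ℝ (F i) y) (v : V) :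
    D v (fun y => ∑ i ∈ s, F i y) y = ∑ i ∈ s, D v (F i) y := by
  unfold D; rw [fderiv_fun_sum h]; simp

lemma D_dir_add (u v : V) : D (u + v) f y = D u f y + D v f y := by simp [D]
lemma D_dir_smul (c : ℝ) (v : V) : D (c • v) f y = c * D v f y := by simp [D]
end Calculus

/-! ### Partial derivatives of functions of `(x,y)` -/

section Partial
variable {n : ℕ} {U : Set (E n)}

/-- The slit domain. -/
def Om (U : Set (E n)) : Set (E n × E n) := U ×ˢ {y : E n | y ≠ 0}

lemma isOpen_Om (hU : IsOpen U) : IsOpen (Om U) := hU.prod isOpen_ne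

/-- Smooth function on the slit domain. -/
def Smo (U : Set (E n)) (f : E n → E n → ℝ) : Prop := Sm (Om U) (fun p => f p.1 p.2)

variable {f g : E n → E n → ℝ} {x y : E n}

lemma pdx_eq (hf : Smo U f) (hU : IsOpen U) (hx : x ∈ U) (hy : y ≠ 0) (k : Fin n) :
    pdx n f k x y = D (e n k, (0 : E n)) (fun p : E n × E n => f p.1 p.2) (x, y) := by
  have h := (hf.diffAt (isOpen_Om hU) (y := (x,y)) ⟨hx, hy⟩).hasFDerivAt
  have h2 : HasFDerivAt (fun x' : E n => (x', y)) (ContinuousLinearMap.inl ℝ (E n) (E n)) x := by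
    exact hasFDerivAt_prodMk_left x y
  have h3 := HasFDerivAt.comp x h h2
  unfold pdx D
  have h4 : (fun x' => f x' y) = (fun p : E n × E n => f p.1 p.2) ∘ (fun x' : E n => (x', y)) := rfl
  rw [h4, h3.fderiv]
  simp

lemma pdy_eq (hf : Smo U f) (hU : IsOpen U) (hx : x ∈ U) (hy : y ≠ 0) (k : Fin n) :
    pdy n f k x y = D ((0 : E n), e n k) (fun p : E n × E n => f p.1 p.2) (x, y) := by
  have h := (hf.diffAt (isOpen_Om hU) (y := (x,y)) ⟨hx, hy⟩).hasFDerivAt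
  have h2 : HasFDerivAt (fun y' : E n => (x, y')) (ContinuousLinearMap.inr ℝ (E n) (E n)) y := by
    exact hasFDerivAt_prodMk_right x y
  have h3 := HasFDerivAt.comp y h h2
  unfold pdy D
  have h4 : (f x) = (fun p : E n × E n => f p.1 p.2) ∘ (fun y' : E n => (x, y')) := rfl
  rw [h4, h3.fderiv]
  simp

lemma Smo.pdx (hf : Smo U f) (hU : IsOpen U) (k : Fin n) : Smo U (pdx n f k) :=
  Sm.congr (Sm.D hf (isOpen_Om hU) (e n k, (0 : E n))) fun _ hp => pdx_eq hf hU hp.1 hp.2 k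

lemma Smo.pdy (hf : Smo U f) (hU : IsOpen U) (k : Fin n) : Smo U (pdy n f k) :=
  Sm.congr (Sm.D hf (isOpen_Om hU) ((0 : E n), e n k)) fun _ hp => pdy_eq hf hU hp.1 hp.2 k

lemma Smo.fiber (hf : Smo U f) (hx : x ∈ U) : Sm {y : E n | y ≠ 0} (f x) := by
  have : ContDiffOn ℝ ∞ (fun y' : E n => (x, y')) {y : E n | y ≠ 0} := by fun_prop
  exact ContDiffOn.comp (g := fun p : E n × E n => f p.1 p.2) hf this (fun y hy => ⟨hx, hy⟩)

lemma Smo.base (hf : Smo U f) (hy : y ≠ 0) : Sm U (fun x => f x y) := by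
  have : ContDiffOn ℝ ∞ (fun x' : E n => (x', y)) U := by fun_prop
  exact ContDiffOn.comp hf this (fun x hx => ⟨hx, hy⟩)

lemma pdx_congr (hU : IsOpen U) (hx : x ∈ U) (hy : y ≠ 0)
    (h : ∀ x ∈ U, ∀ y : E n, y ≠ 0 → f x y = g x y) (k : Fin n) :
    pdx n f k x y = pdx n g k x y :=
  D_congr hU hx (fun z hz => h z hz y hy) (e n k)

lemma pdy_congr (hx : x ∈ U) (hy : y ≠ 0)
    (h : ∀ x ∈ U, ∀ y : E n, y ≠ 0 → f x y = g x y) (k : Fin n) :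
    pdy n f k x y = pdy n g k x y :=
  D_congr (Ω := {y : E n | y ≠ 0}) isOpen_ne hy (fun z hz => h x hx z hz) (e n k)

lemma pdxx_comm (hf : Smo U f) (hU : IsOpen U) (hx : x ∈ U) (hy : y ≠ 0) (j k : Fin n) :
    pdx n (pdx n f k) j x y = pdx n (pdx n f j) k x y := by
  rw [pdx_eq (hf.pdx hU k) hU hx hy, pdx_eq (hf.pdx hU j) hU hx hy,
    D_congr (isOpen_Om hU) (y := (x,y)) ⟨hx, hy⟩ fun p hp => pdx_eq hf hU hp.1 hp.2 k,
    D_congr (isOpen_Om hU) (y := (x,y)) ⟨hx, hy⟩ fun p hp => pdx_eq hf hU hp.1 hp.2 j]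
  exact D_comm hf (isOpen_Om hU) (y := (x,y)) ⟨hx, hy⟩ _ _

lemma pdxy_comm (hf : Smo U f) (hU : IsOpen U) (hx : x ∈ U) (hy : y ≠ 0) (j k : Fin n) :
    pdx n (pdy n f k) j x y = pdy n (pdx n f j) k x y := by
  rw [pdx_eq (hf.pdy hU k) hU hx hy, pdy_eq (hf.pdx hU j) hU hx hy,
    D_congr (isOpen_Om hU) (y := (x,y)) ⟨hx, hy⟩ fun p hp => pdy_eq hf hU hp.1 hp.2 k,
    D_congr (isOpen_Om hU) (y := (x,y)) ⟨hx, hy⟩ fun p hp => pdx_eq hf hU hp.1 hp.2 j]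
  exact D_comm hf (isOpen_Om hU) (y := (x,y)) ⟨hx, hy⟩ _ _

lemma pdyy_comm (hf : Smo U f) (hx : x ∈ U) (hy : y ≠ 0) (j k : Fin n) :
    pdy n (pdy n f k) j x y = pdy n (pdy n f j) k x y :=
  D_comm (hf.fiber hx) isOpen_ne hy _ _

lemma Smo.dx (hf : Smo U f) (hU : IsOpen U) (hx : x ∈ U) (hy : y ≠ 0) :
    DifferentiableAt ℝ (fun x => f x y) x := (hf.base hy).diffAt hU hx
lemma Smo.dy (hf : Smo U f) (hx : x ∈ U) (hy : y ≠ 0) :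
    DifferentiableAt ℝ (f x) y := (hf.fiber hx).diffAt isOpen_ne hy

lemma Smo.add (hf : Smo U f) (hg : Smo U g) : Smo U (fun x y => f x y + g x y) := Sm.add hf hg
lemma Smo.sub (hf : Smo U f) (hg : Smo U g) : Smo U (fun x y => f x y - g x y) := Sm.sub hf hg
lemma Smo.mul (hf : Smo U f) (hg : Smo U g) : Smo U (fun x y => f x y * g x y) := Sm.mul hf hg
lemma Smo.const (c : ℝ) : Smo U (fun _ _ => c) := Sm.const c
lemma Smo.sum {ι : Type*} {s : Finset ι} {F : ι → E n → E n → ℝ} (h : ∀ i ∈ s, Smo U (F i)) :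
    Smo U (fun x y => ∑ i ∈ s, F i x y) := Sm.sum h
lemma Smo.coord (i : Fin n) : Smo U (fun _ y => y i) := by
  unfold Smo Sm; fun_prop

lemma Smo.det {A : Fin n → Fin n → E n → E n → ℝ} (h : ∀ i j, Smo U (A i j)) :
    Smo U (fun x y => (Matrix.of fun i j => A i j x y).det) := by
  simp only [Matrix.det_apply']
  exact Sm.sum fun σ _ => Sm.mul (Sm.const _) (Sm.prod fun i _ => h _ _)

lemma Smo.adj {A : Fin n → Fin n → E n → E n → ℝ} (h : ∀ i j, Smo U (A i j)) (i j : Fin n) :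
    Smo U (fun x y => (Matrix.of fun i j => A i j x y).adjugate i j) := by
  simp only [Matrix.adjugate_apply]
  have : ∀ x y, (Matrix.of fun i j => A i j x y).updateRow j (Pi.single i 1) =
    Matrix.of fun a b => (if a = j then (Pi.single i (1:ℝ) : Fin n → ℝ) b else A a b x y) := by
    intro x y; ext a b; simp [Matrix.updateRow_apply]
  simp only [this]
  apply Smo.det (A := fun a b x y => (if a = j then (Pi.single i (1:ℝ) : Fin n → ℝ) b else A a b x y))
  intro a b
  by_cases hab : a = j
  · simp only [hab, if_true]; exact Smo.const _
  · simp only [hab, if_false]; exact h a b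

end Partial

section SprayPart
variable {n : ℕ} {U : Set (E n)} {F : E n → E n → ℝ}

lemma smo_F (hF : IsFinsler n U F) : Smo U F := hF.smooth

lemma smo_F2 (hF : IsFinsler n U F) : Smo U (F2 n F) := by
  have h := (smo_F hF).mul (smo_F hF)
  exact Sm.congr h fun p _ => by simp [F2, sq]

lemma smo_gm (hF : IsFinsler n U F) (hU : IsOpen U) (i j : Fin n) : Smo U (gm n F i j) :=
  (Smo.const (1/2)).mul (((smo_F2 hF).pdy hU j).pdy hU i)

lemma gm_symm (hF : IsFinsler n U F) {x y : E n} (hx : x ∈ U) (hy : y ≠ 0) (i j : Fin n) :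
    gm n F i j x y = gm n F j i x y := by
  unfold gm
  rw [pdyy_comm (smo_F2 hF) hx hy]

lemma gmat_isUnit (hF : IsFinsler n U F) {x y : E n} (hx : x ∈ U) (hy : y ≠ 0) :
    IsUnit (gmat n F x y).det :=
  (Matrix.isUnit_iff_isUnit_det _).1 (hF.posdef x hx y hy).isUnit

lemma smo_ginv (hF : IsFinsler n U F) (hU : IsOpen U) (i j : Fin n) :
    Smo U (fun x y => ginv n F x y i j) := by
  have h1 : Smo U (fun x y => (gmat n F x y).det) := Smo.det (fun i j => smo_gm hF hU i j)
  have h2 : Smo U (fun x y => (gmat n F x y).adjugate i j) :=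
    Smo.adj (fun i j => smo_gm hF hU i j) i j
  have h3 : Smo U (fun x y => ((gmat n F x y).det)⁻¹) :=
    Sm.inv h1 fun p hp => (gmat_isUnit hF hp.1 hp.2).ne_zero
  refine Sm.congr (h3.mul h2) fun p hp => ?_
  simp [ginv, Matrix.inv_def]

lemma smo_Spray (hF : IsFinsler n U F) (hU : IsOpen U) (i : Fin n) : Smo U (Spray n F i) := by
  refine (Smo.const (1/4)).mul (Smo.sum fun l _ => (smo_ginv hF hU i l).mul (Smo.sub
    (Smo.sum fun k _ => Smo.mul ?_ (Smo.coord k)) ?_))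
  · exact (((smo_F2 hF).pdy hU l).pdx hU k)
  · exact ((smo_F2 hF).pdx hU l)

lemma smo_RiemUp (hF : IsFinsler n U F) (hU : IsOpen U) (i k : Fin n) :
    Smo U (RiemUp n F i k) := by
  have hG := fun i => smo_Spray hF hU (i := i)
  refine Smo.sub (Smo.add (Smo.sub ?_ ?_) ?_) ?_
  · exact (Smo.const 2).mul ((hG i).pdx hU k)
  · exact Smo.sum fun j _ => (Smo.coord j).mul (((hG i).pdy hU k).pdx hU j)
  · exact (Smo.const 2).mul (Smo.sum fun j _ => (hG j).mul (((hG i).pdy hU k).pdy hU j))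
  · exact Smo.sum fun j _ => ((hG i).pdy hU j).mul ((hG j).pdy hU k)

lemma smo_Rlow (hF : IsFinsler n U F) (hU : IsOpen U) (j k : Fin n) :
    Smo U (Rlow n F j k) :=
  Smo.sum fun i _ => (smo_gm hF hU i j).mul (smo_RiemUp hF hU i k)

variable {f g : E n → E n → ℝ} {x y : E n}

lemma smo_Gop (hF : IsFinsler n U F) (hU : IsOpen U) (hf : Smo U f) : Smo U (Gop n F f) :=
  Smo.sub (Smo.sum fun i _ => (Smo.coord i).mul (hf.pdx hU i))
    ((Smo.const 2).mul (Smo.sum fun i _ => (smo_Spray hF hU i).mul (hf.pdy hU i)))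

lemma Gop_congr (hU : IsOpen U) (hx : x ∈ U) (hy : y ≠ 0)
    (h : ∀ x ∈ U, ∀ y : E n, y ≠ 0 → f x y = g x y) : Gop n F f x y = Gop n F g x y := by
  unfold Gop
  simp only [pdx_congr hU hx hy h, pdy_congr hx hy h]

lemma Gop_sub (hU : IsOpen U) (hx : x ∈ U) (hy : y ≠ 0) (hf : Smo U f) (hg : Smo U g) :
    Gop n F (fun x y => f x y - g x y) x y = Gop n F f x y - Gop n F g x y := by
  unfold Gop
  have h1 : ∀ k, pdx n (fun x y => f x y - g x y) k x y = pdx n f k x y - pdx n g k x y :=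
    fun k => D_sub (hf.dx hU hx hy) (hg.dx hU hx hy) _
  have h2 : ∀ k, pdy n (fun x y => f x y - g x y) k x y = pdy n f k x y - pdy n g k x y :=
    fun k => D_sub (hf.dy hx hy) (hg.dy hx hy) _
  simp only [h1, h2, mul_sub, Finset.sum_sub_distrib]
  ring

lemma Gop_mul (hU : IsOpen U) (hx : x ∈ U) (hy : y ≠ 0) (hf : Smo U f) (hg : Smo U g) :
    Gop n F (fun x y => f x y * g x y) x y =
      f x y * Gop n F g x y + g x y * Gop n F f x y := by
  unfold Gop
  have h1 : ∀ k, pdx n (fun x y => f x y * g x y) k x y =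
      f x y * pdx n g k x y + g x y * pdx n f k x y :=
    fun k => D_mul (hf.dx hU hx hy) (hg.dx hU hx hy) _
  have h2 : ∀ k, pdy n (fun x y => f x y * g x y) k x y =
      f x y * pdy n g k x y + g x y * pdy n f k x y :=
    fun k => D_mul (hf.dy hx hy) (hg.dy hx hy) _
  simp only [h1, h2, mul_sub, mul_add, Finset.sum_add_distrib, Finset.mul_sum]
  have e1 : ∀ (a b c d a' b' c' d' : ℝ), a = a' → b = b' → c = c' → d = d' →
    a + b - (c + d) = a' - c' + (b' - d') := by intros; subst_vars; ring
  apply e1 <;> exact Finset.sum_congr rfl fun i _ => by ring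

lemma Gop_sum (hU : IsOpen U) (hx : x ∈ U) (hy : y ≠ 0) {H : Fin n → E n → E n → ℝ}
    (hf : ∀ i, Smo U (H i)) :
    Gop n F (fun x y => ∑ i, H i x y) x y = ∑ i, Gop n F (H i) x y := by
  unfold Gop
  have h1 : ∀ k, pdx n (fun x y => ∑ i, H i x y) k x y = ∑ i, pdx n (H i) k x y :=
    fun k => D_sum (fun i _ => (hf i).dx hU hx hy) _
  have h2 : ∀ k, pdy n (fun x y => ∑ i, H i x y) k x y = ∑ i, pdy n (H i) k x y :=
    fun k => D_sum (fun i _ => (hf i).dy hx hy) _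
  simp only [h1, h2, Finset.mul_sum, Finset.sum_sub_distrib]
  rw [Finset.sum_comm]
  congr 1
  rw [Finset.sum_comm]

lemma pdx_coord (j k : Fin n) : pdx n (fun _ y => y j) k x y = 0 := D_const _ _

lemma pdy_coord (j k : Fin n) : pdy n (fun _ y => y j) k x y = if j = k then 1 else 0 := by
  unfold pdy e
  have : HasFDerivAt (fun y : E n => y j) (ContinuousLinearMap.proj (R := ℝ) j) y :=
    (ContinuousLinearMap.proj (R := ℝ) (φ := fun _ : Fin n => ℝ) j).hasFDerivAt
  rw [this.fderiv]
  simp [Pi.single_apply]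

lemma pdy_Gop (hF : IsFinsler n U F) (hU : IsOpen U) (hx : x ∈ U) (hy : y ≠ 0)
    (hf : Smo U f) (k : Fin n) :
    pdy n (Gop n F f) k x y = Gop n F (pdy n f k) x y + pdx n f k x y
      - 2 * ∑ j, pdy n (Spray n F j) k x y * pdy n f j x y := by
  have hG := fun i => smo_Spray hF hU (i := i)
  have h1 : pdy n (Gop n F f) k x y =
      (∑ i, (y i * pdy n (pdx n f i) k x y + pdx n f i x y * pdy n (fun _ y => y i) k x y))
      - 2 * ∑ i, (Spray n F i x y * pdy n (pdy n f i) k x y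
        + pdy n f i x y * pdy n (Spray n F i) k x y) := by
    have s1 : ∀ i, Smo U (fun x y => y i * pdx n f i x y) :=
      fun i => (Smo.coord i).mul (hf.pdx hU i)
    have s2 : ∀ i, Smo U (fun x y => Spray n F i x y * pdy n f i x y) :=
      fun i => (hG i).mul (hf.pdy hU i)
    have a1 := D_sub ((Smo.sum (s := Finset.univ) fun i _ => s1 i).dy hx hy)
      (((Smo.const 2).mul (Smo.sum (s := Finset.univ) fun i _ => s2 i)).dy hx hy) (e n k)
    have a2 := D_sum (s := Finset.univ) (fun i _ => (s1 i).dy hx hy) (e n k)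
    have a3 := D_const_mul ((Smo.sum (s := Finset.univ) fun i _ => s2 i).dy hx hy) 2 (e n k)
    have a4 := D_sum (s := Finset.univ) (fun i _ => (s2 i).dy hx hy) (e n k)
    have a5 := fun i => D_mul ((Smo.coord (U := U) i).dy hx hy) ((hf.pdx hU i).dy hx hy) (e n k)
    have a6 := fun i => D_mul ((hG i).dy hx hy) ((hf.pdy hU i).dy hx hy) (e n k)
    refine a1.trans ?_
    rw [a2, a3, a4]
    simp only [a5, a6]
    rfl
  rw [h1]
  unfold Gop
  simp only [pdy_coord, Finset.sum_add_distrib, mul_ite, mul_one, mul_zero, Finset.sum_ite_eq',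
    Finset.mem_univ, if_true]
  simp only [pdxy_comm hf hU hx hy]
  simp only [pdyy_comm hf hx hy k]
  have : ∑ i, pdy n f i x y * pdy n (Spray n F i) k x y
    = ∑ j, pdy n (Spray n F j) k x y * pdy n f j x y :=
    Finset.sum_congr rfl fun i _ => mul_comm _ _
  rw [this]
  ring

lemma pdx_Gop (hF : IsFinsler n U F) (hU : IsOpen U) (hx : x ∈ U) (hy : y ≠ 0)
    (hf : Smo U f) (k : Fin n) :
    pdx n (Gop n F f) k x y = Gop n F (pdx n f k) x y
      - 2 * ∑ j, pdx n (Spray n F j) k x y * pdy n f j x y := by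
  have hG := fun i => smo_Spray hF hU (i := i)
  have h1 : pdx n (Gop n F f) k x y =
      (∑ i, (y i * pdx n (pdx n f i) k x y + pdx n f i x y * pdx n (fun _ y => y i) k x y))
      - 2 * ∑ i, (Spray n F i x y * pdx n (pdy n f i) k x y
        + pdy n f i x y * pdx n (Spray n F i) k x y) := by
    have s1 : ∀ i, Smo U (fun x y => y i * pdx n f i x y) :=
      fun i => (Smo.coord i).mul (hf.pdx hU i)
    have s2 : ∀ i, Smo U (fun x y => Spray n F i x y * pdy n f i x y) :=
      fun i => (hG i).mul (hf.pdy hU i)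
    have a1 := D_sub ((Smo.sum (s := Finset.univ) fun i _ => s1 i).dx hU hx hy)
      (((Smo.const 2).mul (Smo.sum (s := Finset.univ) fun i _ => s2 i)).dx hU hx hy) (e n k)
    have a2 := D_sum (s := Finset.univ) (fun i _ => (s1 i).dx hU hx hy) (e n k)
    have a3 := D_const_mul ((Smo.sum (s := Finset.univ) fun i _ => s2 i).dx hU hx hy) 2 (e n k)
    have a4 := D_sum (s := Finset.univ) (fun i _ => (s2 i).dx hU hx hy) (e n k)
    have a5 := fun i => D_mul ((Smo.coord (U := U) i).dx hU hx hy) ((hf.pdx hU i).dx hU hx hy) (e n k)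
    have a6 := fun i => D_mul ((hG i).dx hU hx hy) ((hf.pdy hU i).dx hU hx hy) (e n k)
    refine a1.trans ?_
    rw [a2, a3, a4]
    simp only [a5, a6]
    rfl
  rw [h1]
  unfold Gop
  simp only [pdx_coord, Finset.sum_add_distrib, mul_zero, Finset.sum_const_zero]
  simp only [← pdxy_comm hf hU hx hy]
  simp only [pdxx_comm hf hU hx hy k]
  have : ∑ i, pdy n f i x y * pdx n (Spray n F i) k x y
    = ∑ j, pdx n (Spray n F j) k x y * pdy n f j x y :=
    Finset.sum_congr rfl fun i _ => mul_comm _ _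
  rw [this]
  ring

/-- Euler-Lagrange equation of the spray. -/
lemma euler_lagrange (hF : IsFinsler n U F) (hx : x ∈ U) (hy : y ≠ 0) (l : Fin n) :
    Gop n F (pdy n (F2 n F) l) x y = pdx n (F2 n F) l x y := by
  have hinv : gmat n F x y * ginv n F x y = 1 := Matrix.mul_nonsing_inv _ (gmat_isUnit hF hx hy)
  set c : Fin n → ℝ := fun l => (∑ k, pdx n (pdy n (F2 n F) l) k x y * y k) - pdx n (F2 n F) l x y
    with hc
  have hG : (fun i => Spray n F i x y) = (1/4 : ℝ) • (ginv n F x y).mulVec c := by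
    ext i; simp [Spray, Matrix.mulVec, dotProduct, hc]
  have h1 : (gmat n F x y).mulVec (fun i => Spray n F i x y) = (1/4 : ℝ) • c := by
    rw [hG, Matrix.mulVec_smul, Matrix.mulVec_mulVec, hinv, Matrix.one_mulVec]
  have h2 : ∑ i, gm n F l i x y * Spray n F i x y = 1/4 * c l := by
    have := congrFun h1 l
    simpa [Matrix.mulVec, dotProduct, gmat] using this
  have h3 : ∑ i, Spray n F i x y * pdy n (pdy n (F2 n F) l) i x y = 1/2 * c l := by
    have : ∀ i, Spray n F i x y * pdy n (pdy n (F2 n F) l) i x y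
        = 2 * (gm n F l i x y * Spray n F i x y) := by
      intro i
      rw [gm_symm hF hx hy]; unfold gm; ring
    simp only [this, ← Finset.mul_sum, h2]; ring
  unfold Gop
  rw [h3]
  simp only [hc]
  rw [Finset.sum_congr rfl fun i _ => mul_comm (y i) _]
  ring

/-- `N_{kl} = N^j_k g_{jl}`. -/
def Nl (n : ℕ) (F : E n → E n → ℝ) (k l : Fin n) : E n → E n → ℝ :=
  fun x y => ∑ j, pdy n (Spray n F j) k x y * gm n F j l x y

lemma smo_Nl (hF : IsFinsler n U F) (hU : IsOpen U) (k l : Fin n) : Smo U (Nl n F k l) :=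
  Smo.sum fun j _ => ((smo_Spray hF hU j).pdy hU k).mul (smo_gm hF hU j l)

lemma Gop_pdyy (hF : IsFinsler n U F) (hU : IsOpen U) (hx : x ∈ U) (hy : y ≠ 0) (k l : Fin n) :
    Gop n F (pdy n (pdy n (F2 n F) l) k) x y + pdx n (pdy n (F2 n F) l) k x y
      - pdx n (pdy n (F2 n F) k) l x y = 4 * Nl n F k l x y := by
  have h1 := pdy_Gop hF hU hx hy ((smo_F2 hF).pdy hU l) k
  rw [pdy_congr hx hy (fun x hx y hy => euler_lagrange hF hx hy l),
    ← pdxy_comm (smo_F2 hF) hU hx hy] at h1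
  have h2 : ∑ j, pdy n (Spray n F j) k x y * pdy n (pdy n (F2 n F) l) j x y = 2 * Nl n F k l x y := by
    unfold Nl gm
    rw [Finset.mul_sum]
    exact Finset.sum_congr rfl fun i _ => by ring
  rw [h2] at h1
  linarith

lemma Gop_pdyy_symm (hU : IsOpen U) (hF : IsFinsler n U F) (hx : x ∈ U) (hy : y ≠ 0) (k l : Fin n) :
    Gop n F (pdy n (pdy n (F2 n F) l) k) x y = Gop n F (pdy n (pdy n (F2 n F) k) l) x y :=
  Gop_congr hU hx hy fun _ hx _ hy => pdyy_comm (smo_F2 hF) hx hy _ _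

lemma Gop_gm (hF : IsFinsler n U F) (hU : IsOpen U) (hx : x ∈ U) (hy : y ≠ 0) (k l : Fin n) :
    Gop n F (gm n F k l) x y = Nl n F k l x y + Nl n F l k x y := by
  have h1 := Gop_pdyy hF hU hx hy k l
  have h2 := Gop_pdyy hF hU hx hy l k
  rw [← Gop_pdyy_symm hU hF hx hy] at h2
  have h3 : Gop n F (gm n F k l) x y = 1/2 * Gop n F (pdy n (pdy n (F2 n F) l) k) x y := by
    have := Gop_mul (F := F) hU hx hy (Smo.const (1/2)) (((smo_F2 hF).pdy hU l).pdy hU k)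
    have h0 : Gop n F (fun _ _ => (1/2:ℝ)) x y = 0 := by
      simp [Gop, pdx, pdy]
    rw [h0] at this
    exact this.trans (by ring)
  rw [h3]; linarith

lemma curl (hF : IsFinsler n U F) (hU : IsOpen U) (hx : x ∈ U) (hy : y ≠ 0) (k l : Fin n) :
    pdx n (pdy n (F2 n F) l) k x y - pdx n (pdy n (F2 n F) k) l x y
      = (Nl n F k l x y - Nl n F l k x y) + (Nl n F k l x y - Nl n F l k x y) := by
  have h1 := Gop_pdyy hF hU hx hy k l
  have h2 := Gop_pdyy hF hU hx hy l k
  rw [← Gop_pdyy_symm hU hF hx hy] at h2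
  linarith

lemma Gop_pdxy (hF : IsFinsler n U F) (hU : IsOpen U) (hx : x ∈ U) (hy : y ≠ 0) (k l : Fin n) :
    Gop n F (pdx n (pdy n (F2 n F) l) k) x y =
      pdx n (pdx n (F2 n F) l) k x y + 4 * ∑ j, pdx n (Spray n F j) k x y * gm n F j l x y := by
  have h1 := pdx_Gop hF hU hx hy ((smo_F2 hF).pdy hU l) k
  rw [pdx_congr hU hx hy (fun x hx y hy => euler_lagrange hF hx hy l)] at h1
  have h2 : ∑ j, pdx n (Spray n F j) k x y * pdy n (pdy n (F2 n F) l) j x y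
      = 2 * ∑ j, pdx n (Spray n F j) k x y * gm n F j l x y := by
    unfold gm
    rw [Finset.mul_sum]
    exact Finset.sum_congr rfl fun i _ => by ring
  rw [h2] at h1
  linarith

lemma Gop_Nl (hF : IsFinsler n U F) (hU : IsOpen U) (hx : x ∈ U) (hy : y ≠ 0) (k l : Fin n) :
    Gop n F (Nl n F k l) x y =
      (∑ j, gm n F j l x y * Gop n F (pdy n (Spray n F j) k) x y)
      + (∑ j, ∑ m, pdy n (Spray n F j) k x y * pdy n (Spray n F m) j x y * gm n F m l x y)
      + ∑ j, ∑ m, pdy n (Spray n F j) k x y * pdy n (Spray n F m) l x y * gm n F m j x y := by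
  have hN := fun j => (smo_Spray hF hU j).pdy hU k
  have h1 : Gop n F (Nl n F k l) x y = ∑ j, (pdy n (Spray n F j) k x y * Gop n F (gm n F j l) x y
      + gm n F j l x y * Gop n F (pdy n (Spray n F j) k) x y) := by
    refine (Gop_sum (F := F) hU hx hy (fun j => (hN j).mul (smo_gm hF hU j l))).trans ?_
    exact Finset.sum_congr rfl fun j _ => Gop_mul hU hx hy (hN j) (smo_gm hF hU j l)
  rw [h1]
  simp only [Gop_gm hF hU hx hy, Nl, ← Finset.sum_add_distrib]
  refine Finset.sum_congr rfl fun j _ => ?_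
  rw [Finset.mul_sum, add_comm, add_assoc, ← Finset.sum_add_distrib]
  congr 1
  exact Finset.sum_congr rfl fun m _ => by ring

lemma Rlow_eq (hF : IsFinsler n U F) (hU : IsOpen U) (hx : x ∈ U) (hy : y ≠ 0) (l k : Fin n) :
    Rlow n F l k x y = 2 * (∑ j, pdx n (Spray n F j) k x y * gm n F j l x y)
      - (∑ j, gm n F j l x y * Gop n F (pdy n (Spray n F j) k) x y)
      - (∑ j, ∑ m, pdy n (Spray n F j) k x y * pdy n (Spray n F m) j x y * gm n F m l x y) := by
  have h1 : ∀ i, RiemUp n F i k x y = 2 * pdx n (Spray n F i) k x y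
      - Gop n F (pdy n (Spray n F i) k) x y
      - ∑ j, pdy n (Spray n F i) j x y * pdy n (Spray n F j) k x y := by
    intro i; unfold RiemUp Gop; ring
  unfold Rlow
  rw [Finset.sum_comm (f := fun j m => pdy n (Spray n F j) k x y * pdy n (Spray n F m) j x y * gm n F m l x y),
    Finset.mul_sum, ← Finset.sum_sub_distrib, ← Finset.sum_sub_distrib]
  refine Finset.sum_congr rfl fun i _ => ?_
  rw [h1, mul_sub, mul_sub, Finset.mul_sum]
  congr 1
  · ring
  · exact Finset.sum_congr rfl fun m _ => by ring

theorem Rlow_symm (hF : IsFinsler n U F) (hU : IsOpen U) (hx : x ∈ U) (hy : y ≠ 0) (l k : Fin n) :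
    Rlow n F l k x y = Rlow n F k l x y := by
  have h0 := Gop_congr (F := F) hU hx hy (fun x hx y hy => curl hF hU (x := x) (y := y) hx hy k l)
  have sN := fun k l => smo_Nl hF hU k l
  have sL := fun k l => ((smo_F2 hF).pdy hU l).pdx hU k
  have sd := fun k l => (sN k l).sub (sN l k)
  have h1 : Gop n F (fun x y => (Nl n F k l x y - Nl n F l k x y)
      + (Nl n F k l x y - Nl n F l k x y)) x y =
      2 * (Gop n F (Nl n F k l) x y - Gop n F (Nl n F l k) x y) := by
    have e1 : Gop n F (fun x y => (Nl n F k l x y - Nl n F l k x y)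
      + (Nl n F k l x y - Nl n F l k x y)) x y = Gop n F (fun x y =>
        (Nl n F k l x y - Nl n F l k x y) - (Nl n F l k x y - Nl n F k l x y)) x y := by
      congr 1; ext x y; ring
    rw [e1, Gop_sub (F := F) hU hx hy (sd k l) (sd l k), Gop_sub hU hx hy (sN k l) (sN l k),
      Gop_sub hU hx hy (sN l k) (sN k l)]
    ring
  rw [h1, Gop_sub hU hx hy (sL k l) (sL l k), Gop_pdxy hF hU hx hy, Gop_pdxy hF hU hx hy,
    Gop_Nl hF hU hx hy, Gop_Nl hF hU hx hy, pdxx_comm (smo_F2 hF) hU hx hy k l] at h0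
  have h2 : ∑ j, ∑ m, pdy n (Spray n F j) k x y * pdy n (Spray n F m) l x y * gm n F m j x y
    = ∑ j, ∑ m, pdy n (Spray n F j) l x y * pdy n (Spray n F m) k x y * gm n F m j x y := by
    rw [Finset.sum_comm]
    refine Finset.sum_congr rfl fun j _ => Finset.sum_congr rfl fun m _ => ?_
    rw [gm_symm hF hx hy]; ring
  rw [Rlow_eq hF hU hx hy, Rlow_eq hF hU hx hy]
  rw [h2] at h0
  linarith

end SprayPart

/-! ### Linear algebra -/

lemma Bca {V : Type*} [AddCommGroup V] [Module ℝ V] (a B : V →ₗ[ℝ] V →ₗ[ℝ] ℝ) (y e : V)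
    (hsym : ∀ u v, a u v = a v u) (hay : ∀ u, a u y = 0) (he : 0 < a e e)
    (hpos : ∀ v, (∃ s : ℝ, v = s • y) ∨ 0 < a v v) (hBy : ∀ u, B u y = 0)
    (hT : ∀ z u v w, B z u * a v w + B z v * a u w + B z w * a u v =
      B u z * a v w + B u v * a z w + B u w * a z v) :
    ∃ c : ℝ, ∀ z u, B z u = c * a z u := by
  have hyB : ∀ u, 0 < a u u → B y u = 0 := by
    intro u hu
    have h := hT y u u u
    rw [hBy, hsym y u, hay] at h
    have : B y u * a u u = 0 := by linarith
    exact (mul_eq_zero.1 this).resolve_right hu.ne'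
  have hyB' : ∀ u, B y u = 0 := by
    intro u
    rcases hpos u with ⟨s, rfl⟩ | h
    · simp [hBy]
    · exact hyB u h
  have step1 : ∀ z u, a z u = 0 → B z u = 0 := by
    intro z u h0
    rcases hpos z with ⟨s, rfl⟩ | hz
    · simp [hyB']
    rcases hpos u with ⟨s, rfl⟩ | hu
    · simp [hBy]
    have h1 := hT z u u u
    have h2 := hT u z z z
    rw [h0] at h1
    rw [hsym u z, h0] at h2
    have h1' : (3 * B z u - B u z) * a u u = 0 := by linarith
    have h2' : (3 * B u z - B z u) * a z z = 0 := by linarith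
    have h3 := (mul_eq_zero.1 h1').resolve_right hu.ne'
    have h4 := (mul_eq_zero.1 h2').resolve_right hz.ne'
    linarith
  have step2 : ∀ z u, 0 < a u u → B z u * a u u = a z u * B u u := by
    intro z u hu
    have h := step1 (z - (a z u / a u u) • u) u (by
      simp; field_simp; ring)
    simp at h
    field_simp at h
    linarith
  have step2' : ∀ z u, 0 < a u u → B u z * a u u = a z u * B u u := by
    intro z u hu
    have h := step1 u (z - (a z u / a u u) • u) (by
      simp [hsym u z]; field_simp; ring)
    simp at h
    field_simp at h
    linarith
  set c := B e e / a e e with hc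
  have hce : B e e = c * a e e := by rw [hc]; field_simp
  have c1 : ∀ u, 0 < a u u → a e u ≠ 0 → B u u = c * a u u := by
    intro u hu h0
    have h1 := step2 e u hu
    have h2 := step2' u e he
    rw [hce, hsym u e] at h2
    have h3 : B e u = a e u * c := by
      have : (B e u - a e u * c) * a e e = 0 := by linarith
      linarith [(mul_eq_zero.1 this).resolve_right he.ne']
    rw [h3] at h1
    have : a e u * (B u u - c * a u u) = 0 := by linarith
    linarith [(mul_eq_zero.1 this).resolve_left h0]
  have c2 : ∀ u, 0 < a u u → B u u = c * a u u := by
    intro u hu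
    by_cases h0 : a e u = 0
    · have h0' : a u e = 0 := by rw [hsym, h0]
      have h := c1 (e + u) (by simp [h0, h0']; linarith) (by simp [h0]; exact he.ne')
      simp [h0, h0', step1 e u h0, step1 u e h0'] at h
      rw [hce] at h
      linarith
    · exact c1 u hu h0
  refine ⟨c, fun z u => ?_⟩
  rcases hpos u with ⟨s, rfl⟩ | hu
  · simp [hBy, hay]
  · have h := step2 z u hu
    rw [c2 u hu] at h
    have : (B z u - c * a z u) * a u u = 0 := by linarith
    linarith [(mul_eq_zero.1 this).resolve_right hu.ne']

/-! ### Homogeneous functions -/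
section Homog
variable {n : ℕ} {f : E n → ℝ}

/-- The slit fibre. -/
abbrev O (n : ℕ) : Set (E n) := {y : E n | y ≠ 0}

lemma isOpen_O : IsOpen (O n) := isOpen_ne

/-- positively homogeneous of degree `k`. -/
def Hom (k : ℤ) (f : E n → ℝ) : Prop := ∀ y : E n, y ≠ 0 → ∀ c : ℝ, 0 < c → f (c • y) = c ^ k * f y

lemma Hom.D {k : ℤ} (hf : Hom k f) (hs : Sm (O n) f) (v : E n) : Hom (k - 1) (D v f) := by
  intro y hy c hc
  have hcy : c • y ≠ 0 := smul_ne_zero hc.ne' hy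
  have h1 : Paper.D v (fun y => f (c • y)) y = Paper.D v (fun y => c ^ k * f y) y :=
    D_congr (isOpen_O) hy (fun z hz => hf z hz c hc) v
  rw [D_const_mul (hs.diffAt isOpen_O hy)] at h1
  have h2 : HasFDerivAt (fun y : E n => c • y) (c • ContinuousLinearMap.id ℝ (E n)) y :=
    (hasFDerivAt_id y).const_smul c
  have h3 := (hs.diffAt isOpen_O hcy).hasFDerivAt.comp y h2
  have h4 : Paper.D v (fun y => f (c • y)) y = c * Paper.D v f (c • y) := by
    unfold Paper.D
    have : (fun y => f (c • y)) = f ∘ (fun y : E n => c • y) := rfl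
    rw [this, h3.fderiv]; simp
  rw [h4] at h1
  rw [zpow_sub_one₀ hc.ne']
  field_simp
  linarith

lemma line_deriv (hs : Sm (O n) f) {y v : E n} {t : ℝ} (h : y + t • v ≠ 0) :
    HasDerivAt (fun t : ℝ => f (y + t • v)) (D v f (y + t • v)) t := by
  have h1 := (hs.diffAt isOpen_O h).hasFDerivAt
  have h2 : HasDerivAt (fun t : ℝ => y + t • v) v t := by
    simpa using ((hasDerivAt_id t).smul_const v).const_add y
  exact h1.comp_hasDerivAt t h2

lemma Hom.euler {k : ℤ} (hf : Hom k f) (hs : Sm (O n) f) {y : E n} (hy : y ≠ 0) :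
    Paper.D y f y = k * f y := by
  have h1 := line_deriv (n := n) (y := 0) (v := y) (t := 1) hs (by simpa using hy)
  have h2 : HasDerivAt (fun t : ℝ => t ^ k * f y) (k * f y) 1 := by
    have := (hasDerivAt_zpow k (1:ℝ) (Or.inl one_ne_zero)).mul_const (f y)
    simpa using this
  have h3 : (fun t : ℝ => f (0 + t • y)) =ᶠ[nhds 1] (fun t : ℝ => t ^ k * f y) := by
    filter_upwards [lt_mem_nhds (zero_lt_one (α := ℝ))] with t ht
    rw [zero_add, hf y hy t ht]
  have h4 := (h2.congr_of_eventuallyEq h3).unique h1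
  simpa using h4.symm

lemma D2_dir_add (hs : Sm (O n) f) {y : E n} (hy : y ≠ 0) (w u v : E n) :
    D w (D (u + v) f) y = D w (D u f) y + D w (D v f) y := by
  rw [D_comm hs isOpen_O hy, D_dir_add, D_comm hs isOpen_O hy u, D_comm hs isOpen_O hy v]

lemma D2_dir_smul (hs : Sm (O n) f) {y : E n} (hy : y ≠ 0) (w : E n) (c : ℝ) (v : E n) :
    D w (D (c • v) f) y = c * D w (D v f) y := by
  rw [D_comm hs isOpen_O hy, D_dir_smul, D_comm hs isOpen_O hy v]

/-- The Hessian as a bilinear map. -/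
def Hs (f : E n → ℝ) (hs : Sm (O n) f) (y : E n) (hy : y ≠ 0) : E n →ₗ[ℝ] E n →ₗ[ℝ] ℝ :=
  LinearMap.mk₂ ℝ (fun u v => D u (D v f) y)
    (fun u u' v => D_dir_add u u') (fun c u v => D_dir_smul c u)
    (fun u v v' => D2_dir_add hs hy u v v') (fun c u v => D2_dir_smul hs hy u c v)

@[simp] lemma Hs_apply (hs : Sm (O n) f) (y : E n) (hy : y ≠ 0) (u v : E n) :
    Hs f hs y hy u v = D u (D v f) y := rfl

lemma bilin_expand (Q : E n →ₗ[ℝ] E n →ₗ[ℝ] ℝ) (y z : E n) :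
    Q y z = ∑ i, ∑ j, Q (e n i) (e n j) * y i * z j := by
  have hy : ∀ y : E n, y = ∑ i, y i • e n i := fun y => by
    ext j; simp [e, Pi.single_apply]
  conv_lhs => rw [hy y, hy z]
  simp only [map_sum, LinearMap.sum_apply, map_smul, LinearMap.smul_apply, smul_eq_mul]
  rw [Finset.sum_comm]
  refine Finset.sum_congr rfl fun i _ => ?_
  rw [Finset.mul_sum]
  exact Finset.sum_congr rfl fun j _ => by ring

lemma lin_expand (Q : E n →ₗ[ℝ] ℝ) (y : E n) :
    Q y = ∑ i, Q (e n i) * y i := by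
  have hy : ∀ y : E n, y = ∑ i, y i • e n i := fun y => by
    ext j; simp [e, Pi.single_apply]
  conv_lhs => rw [hy y]
  simp only [map_sum, map_smul, smul_eq_mul]
  exact Finset.sum_congr rfl fun j _ => by ring

lemma exists_indep (hn : 3 ≤ n) {y : E n} (φ : E n →ₗ[ℝ] ℝ) :
    ∃ z, φ z = 0 ∧ ∀ s : ℝ, z ≠ s • y := by
  by_contra! h
  have h1 : LinearMap.ker φ ≤ Submodule.span ℝ {y} := by
    intro z hz
    obtain ⟨s, hs⟩ := h z hz
    exact Submodule.mem_span_singleton.2 ⟨s, hs.symm⟩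
  have h2 := Submodule.finrank_mono h1
  have h3 : Module.finrank ℝ (Submodule.span ℝ {y}) ≤ 1 := by
    have := finrank_span_le_card (R := ℝ) ({y} : Set (E n))
    simpa using this
  have h4 := φ.finrank_range_add_finrank_ker
  have h5 : Module.finrank ℝ (LinearMap.range φ) ≤ 1 := by
    simpa using Submodule.finrank_le (LinearMap.range φ)
  simp at h4
  omega

end Homog

/-! ### C-reducible norms are Randers norms -/

section Randers
variable {n : ℕ} {f : E n → ℝ}

lemma D_three {p1 q1 p2 q2 p3 q3 : E n → ℝ} {y : E n} (z : E n)
    (h1 : DifferentiableAt ℝ p1 y) (k1 : DifferentiableAt ℝ q1 y)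
    (h2 : DifferentiableAt ℝ p2 y) (k2 : DifferentiableAt ℝ q2 y)
    (h3 : DifferentiableAt ℝ p3 y) (k3 : DifferentiableAt ℝ q3 y) :
    D z (fun y => p1 y * q1 y + p2 y * q2 y + p3 y * q3 y) y =
      (p1 y * D z q1 y + q1 y * D z p1 y) + (p2 y * D z q2 y + q2 y * D z p2 y)
      + (p3 y * D z q3 y + q3 y * D z p3 y) := by
  rw [D_add ((h1.fun_mul k1).fun_add (h2.fun_mul k2)) (h3.fun_mul k3),
    D_add (h1.fun_mul k1) (h2.fun_mul k2), D_mul h1 k1, D_mul h2 k2, D_mul h3 k3]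

lemma const_of_D (hn : 3 ≤ n) (hs : Sm (O n) f) (h : ∀ y, y ≠ 0 → ∀ v, D v f y = 0) :
    ∀ y z : E n, y ≠ 0 → z ≠ 0 → f y = f z := by
  intro y z hy hz
  have hc : IsPreconnected (O n) := by
    have := (isConnected_compl_singleton_of_one_lt_rank (E := E n) (by
      rw [rank_fin_fun]; exact_mod_cast (by omega : 1 < n)) (0 : E n)).isPreconnected
    exact this
  refine isOpen_O.is_const_of_fderiv_eq_zero hc
    (fun y hy => (hs.diffAt isOpen_O hy).differentiableWithinAt) ?_ hy hz
  intro y hy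
  ext v
  exact h y hy v

/-- Pointwise identification of a smooth function. -/
lemma Sm_of_local {g : E n → ℝ}
    (h : ∀ y : E n, y ≠ 0 → ∃ (k : E n → ℝ) (A : E n → ℝ), Sm (O n) k ∧ Sm (O n) A ∧ A y ≠ 0 ∧
      ∀ z, z ≠ 0 → A z ≠ 0 → g z = k z * (A z)⁻¹) : Sm (O n) g := by
  intro y hy
  obtain ⟨k, A, hk, hA, h0, hg⟩ := h y hy
  have h1 : ContDiffAt ℝ ∞ (fun z => k z * (A z)⁻¹) y :=
    (hk.at isOpen_O hy).mul ((hA.at isOpen_O hy).inv h0)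
  have h2 : g =ᶠ[nhds y] (fun z => k z * (A z)⁻¹) := by
    filter_upwards [isOpen_O.mem_nhds hy,
      (hA.at isOpen_O hy).continuousAt.eventually_ne h0] with z hz hz2 using hg z hz hz2
  exact (h1.congr_of_eventuallyEq h2).contDiffWithinAt

theorem riem_part (hn : 3 ≤ n) (hs : Sm (O n) f) (hpos : ∀ y, y ≠ 0 → 0 < f y)
    (hhom : Hom 1 f) (lam : E n → E n →ₗ[ℝ] ℝ) (c : E n → ℝ)
    (hlam : ∀ y, y ≠ 0 → ∀ u v w, D u (D v (D w f)) y =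
      lam y u * D v (D w f) y + lam y v * D u (D w f) y + lam y w * D u (D v f) y)
    (lamy : ∀ y, y ≠ 0 → lam y y = -1) (slam : ∀ u, Sm (O n) (fun y => lam y u))
    (sc : Sm (O n) c) (cne : ∀ y, y ≠ 0 → c y ≠ 0)
    (hc : ∀ y, y ≠ 0 → ∀ z u, D z (fun y' => lam y' u) y = lam y z * lam y u + c y * D z (D u f) y)
    (dc : ∀ y, y ≠ 0 → ∀ w, D w c y = c y * lam y w) :
    ∃ (a : Matrix (Fin n) (Fin n) ℝ) (b : E n), a.IsSymm ∧ a.PosDef ∧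
        (∑ i, ∑ j, a⁻¹ i j * b i * b j < 1) ∧
        ∀ y : E n, y ≠ 0 →
          f y = Real.sqrt (∑ i, ∑ j, a i j * y i * y j) + ∑ i, b i * y i := by
  have hO := isOpen_O (n := n)
  have s1 := fun v => hs.D hO v
  have s2 := fun u v => (s1 v).D hO u
  have eul0 : ∀ y, y ≠ 0 → D y f y = f y := fun y hy => by simpa using hhom.euler hs hy
  have ay : ∀ y, y ≠ 0 → ∀ v, D v (D y f) y = 0 := fun y hy v => by
    rw [D_comm hs hO hy]; simpa using (hhom.D hs v).euler (s1 v) hy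
  obtain ⟨A, hA⟩ : ∃ A : E n → ℝ, ∀ y, A y = -(c y)⁻¹ := ⟨_, fun _ => rfl⟩
  have sA : Sm (O n) A := by
    have : Sm (O n) (fun y => -(c y)⁻¹) := (sc.inv cne).neg
    exact this.congr (fun y _ => hA y)
  have cA : ∀ y, y ≠ 0 → c y * A y = -1 := fun y hy => by
    rw [hA]; have := cne y hy; field_simp
  have dA : ∀ y, y ≠ 0 → ∀ u, D u A y = -(lam y u * A y) := by
    intro y hy u
    have h : D u (fun y => c y * A y) y = D u (fun _ => (-1:ℝ)) y :=
      D_congr hO hy (fun y hy => cA y hy) u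
    rw [D_mul (sc.diffAt hO hy) (sA.diffAt hO hy), D_const, dc y hy] at h
    have : c y * (D u A y + lam y u * A y) = 0 := by linarith
    linarith [(mul_eq_zero.1 this).resolve_left (cne y hy)]
  have ddA : ∀ y, y ≠ 0 → ∀ u v, D v (D u A) y = D v (D u f) y := by
    intro y hy u v
    have h1 : D v (D u A) y = D v (fun y => (-1) * (lam y u * A y)) y :=
      D_congr hO hy (fun y hy => by rw [dA y hy]; ring) v
    rw [h1, D_const_mul (((slam u).mul sA).diffAt hO hy),
      D_mul ((slam u).diffAt hO hy) (sA.diffAt hO hy), dA y hy, hc y hy]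
    linear_combination (- D v (D u f) y) * cA y hy
  obtain ⟨y0, hy0⟩ : ∃ y0 : E n, y0 ≠ 0 := by
    obtain ⟨z, -, hz⟩ := exists_indep hn (y := (0 : E n)) 0
    exact ⟨z, by simpa using hz 0⟩
  -- the linear part
  have sB : Sm (O n) (fun y => f y - A y) := hs.sub sA
  have dB : ∀ y, y ≠ 0 → ∀ u, D u (fun y => f y - A y) y = D u f y - D u A y :=
    fun y hy u => D_sub (hs.diffAt hO hy) (sA.diffAt hO hy) u
  have ddB : ∀ u, ∀ y, y ≠ 0 → ∀ v, D v (D u (fun y => f y - A y)) y = 0 := by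
    intro u y hy v
    rw [D_congr hO hy (fun y hy => dB y hy u) v,
      D_sub ((s1 u).diffAt hO hy) ((sA.D hO u).diffAt hO hy), ddA y hy, sub_self]
  have cB : ∀ u, ∀ y, y ≠ 0 → D u (fun y => f y - A y) y = D u (fun y => f y - A y) y0 :=
    fun u y hy => const_of_D hn (sB.D hO u) (ddB u) y y0 hy hy0
  have Beq : ∀ y, y ≠ 0 → f y - A y = ∑ i, D (e n i) (fun y => f y - A y) y0 * y i := by
    intro y hy
    have h1 : f y - A y = D y (fun y => f y - A y) y := by
      rw [dB y hy, eul0 y hy, dA y hy, lamy y hy]; ring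
    rw [h1]
    have h2 := lin_expand (fderiv ℝ (fun y => f y - A y) y).toLinearMap y
    refine (h2.trans ?_)
    refine Finset.sum_congr rfl fun i _ => ?_
    rw [← cB (e n i) y hy]; rfl
  -- the quadratic part
  have cQ : ∀ u v, ∀ y, y ≠ 0 → A y * D u (D v f) y + lam y u * lam y v * (A y * A y) =
      A y0 * D u (D v f) y0 + lam y0 u * lam y0 v * (A y0 * A y0) := by
    intro u v y hy
    refine const_of_D hn (f := fun y => A y * D u (D v f) y + lam y u * lam y v * (A y * A y))
      ((sA.mul (s2 u v)).add (((slam u).mul (slam v)).mul (sA.mul sA))) ?_ y y0 hy hy0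
    intro y hy w
    rw [D_add ((sA.mul (s2 u v)).diffAt hO hy)
        ((((slam u).mul (slam v)).mul (sA.mul sA)).diffAt hO hy),
      D_mul (sA.diffAt hO hy) ((s2 u v).diffAt hO hy),
      D_mul (((slam u).mul (slam v)).diffAt hO hy) ((sA.mul sA).diffAt hO hy),
      D_mul ((slam u).diffAt hO hy) ((slam v).diffAt hO hy),
      D_mul (sA.diffAt hO hy) (sA.diffAt hO hy), dA y hy, hc y hy, hc y hy, hlam y hy]
    linear_combination (A y * (lam y u * D w (D v f) y + lam y v * D w (D u f) y)) * cA y hy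
  obtain ⟨q, hq⟩ : ∃ q : Matrix (Fin n) (Fin n) ℝ, ∀ i j, q i j =
      A y0 * D (e n i) (D (e n j) f) y0 + lam y0 (e n i) * lam y0 (e n j) * (A y0 * A y0) :=
    ⟨Matrix.of fun i j => _, fun _ _ => rfl⟩
  have qy : ∀ y, y ≠ 0 → ∑ i, ∑ j, q i j * y i * y j = A y * A y := by
    intro y hy
    let Q : E n →ₗ[ℝ] E n →ₗ[ℝ] ℝ := LinearMap.mk₂ ℝ
      (fun u v => A y * D u (D v f) y + lam y u * lam y v * (A y * A y))
      (fun u u' v => by simp only [← Hs_apply hs y hy, map_add, LinearMap.add_apply]; ring)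
      (fun t u v => by
        simp only [← Hs_apply hs y hy, map_smul, LinearMap.smul_apply, smul_eq_mul]; ring)
      (fun u v v' => by simp only [← Hs_apply hs y hy, map_add]; ring)
      (fun t u v => by simp only [← Hs_apply hs y hy, map_smul, smul_eq_mul]; ring)
    have h := bilin_expand Q y y
    have h2 : Q y y = A y * A y := by
      simp only [Q, LinearMap.mk₂_apply, ay y hy, lamy y hy]; ring
    rw [← h2, h]
    refine Finset.sum_congr rfl fun i _ => Finset.sum_congr rfl fun j _ => ?_
    rw [hq, ← cQ _ _ y hy]; rfl
  have Ane : ∀ y, y ≠ 0 → A y ≠ 0 := fun y hy h => by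
    have := cA y hy; rw [h] at this; norm_num at this
  have Apos : ∀ y, y ≠ 0 → 0 < A y := by
    intro y hy
    have hy' : -y ≠ 0 := neg_ne_zero.2 hy
    have h1 := qy y hy
    have h2 := qy (-y) hy'
    simp only [Pi.neg_apply, mul_neg, neg_mul, neg_neg] at h2
    rw [h1] at h2
    have h3 := Beq y hy
    have h4 := Beq (-y) hy'
    simp only [Pi.neg_apply, mul_neg, Finset.sum_neg_distrib] at h4
    rw [← h3] at h4
    have h5 := hpos y hy
    have h6 := hpos (-y) hy'
    rcases mul_self_eq_mul_self_iff.1 h2 with h | h <;> linarith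
  have hsym : q.IsSymm := by
    ext i j
    rw [Matrix.transpose_apply, hq, hq, D_comm hs hO hy0]; ring
  have hdot : ∀ y : E n, y ⬝ᵥ (q.mulVec y) = ∑ i, ∑ j, q i j * y i * y j := by
    intro y
    simp only [dotProduct, Matrix.mulVec, Finset.mul_sum]
    exact Finset.sum_congr rfl fun i _ => Finset.sum_congr rfl fun j _ => by ring
  have hPD : q.PosDef := by
    refine Matrix.PosDef.of_dotProduct_mulVec_pos ?_ ?_
    · rw [Matrix.IsHermitian, Matrix.conjTranspose_eq_transpose_of_trivial]; exact hsym
    · intro y hy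
      rw [star_trivial, hdot, qy y hy]
      exact mul_self_pos.2 (Ane y hy)
  have hfin : ∀ y : E n, y ≠ 0 → f y = Real.sqrt (∑ i, ∑ j, q i j * y i * y j) +
      ∑ i, D (e n i) (fun y => f y - A y) y0 * y i := by
    intro y hy
    rw [qy y hy, Real.sqrt_mul_self (Apos y hy).le, ← Beq y hy]; ring
  refine ⟨q, fun i => D (e n i) (fun y => f y - A y) y0, hsym, hPD, ?_, hfin⟩
  generalize hb : (fun i => D (e n i) (fun y => f y - A y) y0) = b
  have hb' : ∀ i, D (e n i) (fun y => f y - A y) y0 = b i := fun i => congrFun hb i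
  simp only [hb'] at hfin
  set w : E n := q⁻¹.mulVec b with hw
  have hsum : ∑ i, ∑ j, q⁻¹ i j * b i * b j = b ⬝ᵥ w := by
    simp only [hw, dotProduct, Matrix.mulVec, Finset.mul_sum]
    exact Finset.sum_congr rfl fun i _ => Finset.sum_congr rfl fun j _ => by ring
  have hqw : q.mulVec w = b := by
    rw [hw, Matrix.mulVec_mulVec, Matrix.mul_nonsing_inv _ hPD.det_pos.ne'.isUnit, Matrix.one_mulVec]
  rw [hsum]
  by_cases hw0 : w = 0
  · rw [hw0]; simp
  have h1 := hpos (-w) (neg_ne_zero.2 hw0)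
  rw [hfin (-w) (neg_ne_zero.2 hw0)] at h1
  simp only [Pi.neg_apply, mul_neg, neg_mul, neg_neg, Finset.sum_neg_distrib] at h1
  rw [← hdot w, hqw, dotProduct_comm] at h1
  have h2 : ∑ i, b i * w i = b ⬝ᵥ w := rfl
  rw [h2] at h1
  have h3 : 0 < b ⬝ᵥ w := by
    have := qy w hw0
    rw [← hdot w, hqw, dotProduct_comm] at this
    rw [this]; exact mul_self_pos.2 (Ane w hw0)
  by_contra hge
  push Not at hge
  have : Real.sqrt (b ⬝ᵥ w) ≤ b ⬝ᵥ w := by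
    rw [Real.sqrt_le_left h3.le]; nlinarith
  linarith

theorem randers_of_cred (hn : 3 ≤ n) (hs : Sm (O n) f) (hpos : ∀ y, y ≠ 0 → 0 < f y)
    (hhom : Hom 1 f) (hconv : ∀ y, y ≠ 0 → ∀ v, (∃ s : ℝ, v = s • y) ∨ 0 < D v (D v f) y)
    (hC : ∀ y, y ≠ 0 → ∃ lam : E n →ₗ[ℝ] ℝ, ∀ u v w, D u (D v (D w f)) y =
      lam u * D v (D w f) y + lam v * D u (D w f) y + lam w * D u (D v f) y) :
    ∃ (a : Matrix (Fin n) (Fin n) ℝ) (b : E n), a.IsSymm ∧ a.PosDef ∧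
        (∑ i, ∑ j, a⁻¹ i j * b i * b j < 1) ∧
        ∀ y : E n, y ≠ 0 →
          f y = Real.sqrt (∑ i, ∑ j, a i j * y i * y j) + ∑ i, b i * y i := by
  have hO := isOpen_O (n := n)
  have s1 := fun v => hs.D hO v
  have s2 := fun u v => (s1 v).D hO u
  have s3 := fun u v w => (s2 v w).D hO u
  have hom1 := fun v => hhom.D hs v
  have hom2 := fun u v => (hom1 v).D (s1 v) u
  have hom3 := fun u v w => (hom2 v w).D (s2 v w) u
  have eul0 : ∀ y, y ≠ 0 → D y f y = f y := fun y hy => by simpa using hhom.euler hs hy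
  have ay : ∀ y, y ≠ 0 → ∀ v, D v (D y f) y = 0 := fun y hy v => by
    rw [D_comm hs hO hy]; simpa using (hom1 v).euler (s1 v) hy
  have ya : ∀ y, y ≠ 0 → ∀ v, D y (D v f) y = 0 := fun y hy v => by
    rw [D_comm hs hO hy, ay y hy]
  have asym : ∀ y, y ≠ 0 → ∀ u v, D u (D v f) y = D v (D u f) y :=
    fun y hy u v => D_comm hs hO hy u v
  have T12 : ∀ y, y ≠ 0 → ∀ u v w, D u (D v (D w f)) y = D v (D u (D w f)) y :=
    fun y hy u v w => D_comm (s1 w) hO hy u v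
  have Ty : ∀ y, y ≠ 0 → ∀ u v, D y (D u (D v f)) y = - D u (D v f) y := fun y hy u v => by
    have := (hom2 u v).euler (s2 u v) hy; rw [this]; norm_num
  have exe : ∀ y, y ≠ 0 → ∀ φ : E n →ₗ[ℝ] ℝ, ∃ v, φ v = 0 ∧ 0 < D v (D v f) y := by
    intro y hy φ
    obtain ⟨z, hz, hz2⟩ := exists_indep hn (y := y) φ
    refine ⟨z, hz, (hconv y hy z).resolve_left ?_⟩
    rintro ⟨s, rfl⟩; exact hz2 s rfl
  have exe0 : ∀ y, y ≠ 0 → ∃ v, 0 < D v (D v f) y := fun y hy => by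
    obtain ⟨v, -, hv⟩ := exe y hy 0; exact ⟨v, hv⟩
  -- choose lambda
  have hC' : ∀ y, ∃ lam : E n →ₗ[ℝ] ℝ, y ≠ 0 → ∀ u v w, D u (D v (D w f)) y =
      lam u * D v (D w f) y + lam v * D u (D w f) y + lam w * D u (D v f) y := by
    intro y
    by_cases hy : y = 0
    · exact ⟨0, fun h => absurd hy h⟩
    · obtain ⟨l, hl⟩ := hC y hy; exact ⟨l, fun _ => hl⟩
  choose lam hlam using hC'
  have lamy : ∀ y, y ≠ 0 → lam y y = -1 := by
    intro y hy
    obtain ⟨v, hv⟩ := exe0 y hy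
    have h := hlam y hy y v v
    rw [Ty y hy, ya y hy] at h
    have : (lam y y + 1) * D v (D v f) y = 0 := by linarith
    linarith [(mul_eq_zero.1 this).resolve_right hv.ne']
  have slam : ∀ u, Sm (O n) (fun y => lam y u) := by
    intro u
    refine Sm_of_local fun y hy => ?_
    obtain ⟨w, hw⟩ := exe0 y hy
    refine ⟨fun z => D u (D w (D w f)) z * D w (D w f) z
      - 2/3 * (D w (D w (D w f)) z * D u (D w f) z),
      fun z => D w (D w f) z * D w (D w f) z,
      ((s3 _ _ _).mul (s2 _ _)).sub ((Sm.const _).mul ((s3 _ _ _).mul (s2 _ _))),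
      (s2 _ _).mul (s2 _ _), (mul_pos hw hw).ne', ?_⟩
    intro z hz hA
    have h1 := hlam z hz u w w
    have h2 := hlam z hz w w w
    beta_reduce at hA ⊢
    rw [h1, h2, eq_mul_inv_iff_mul_eq₀ hA]
    ring
  -- the derivative of lambda
  set L : E n → E n → E n → ℝ := fun y z u => D z (fun y' => lam y' u) y with hL
  have L_add1 : ∀ y z z' u, L y (z + z') u = L y z u + L y z' u := fun y z z' u => D_dir_add z z'
  have L_smul1 : ∀ y (c : ℝ) z u, L y (c • z) u = c * L y z u := fun y c z u => D_dir_smul c z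
  have L_add2 : ∀ y, y ≠ 0 → ∀ z u u', L y z (u + u') = L y z u + L y z u' := by
    intro y hy z u u'
    simp only [hL, map_add]
    exact D_add ((slam u).diffAt hO hy) ((slam u').diffAt hO hy) z
  have L_smul2 : ∀ y, y ≠ 0 → ∀ z (c : ℝ) u, L y z (c • u) = c * L y z u := by
    intro y hy z c u
    simp only [hL, map_smul, smul_eq_mul]
    exact D_const_mul ((slam u).diffAt hO hy) c z
  have D4 : ∀ y, y ≠ 0 → ∀ z u v w, D z (D u (D v (D w f))) y =
      (lam y u * (D z (D v (D w f)) y) + D v (D w f) y * L y z u)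
      + (lam y v * (D z (D u (D w f)) y) + D u (D w f) y * L y z v)
      + (lam y w * (D z (D u (D v f)) y) + D u (D v f) y * L y z w) := by
    intro y hy z u v w
    rw [D_congr hO hy (fun y hy => hlam y hy u v w) z]
    exact D_three z ((slam u).diffAt hO hy) ((s2 v w).diffAt hO hy) ((slam v).diffAt hO hy)
      ((s2 u w).diffAt hO hy) ((slam w).diffAt hO hy) ((s2 u v).diffAt hO hy)
  have D4c : ∀ y, y ≠ 0 → ∀ z u v w, D z (D u (D v (D w f))) y = D u (D z (D v (D w f))) y :=
    fun y hy z u v w => D_comm (s2 v w) hO hy z u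
  have D4y : ∀ y, y ≠ 0 → ∀ u v w, D y (D u (D v (D w f))) y = -2 * D u (D v (D w f)) y := by
    intro y hy u v w
    have := (hom3 u v w).euler (s3 u v w) hy; rw [this]; norm_num
  have Ly : ∀ y, y ≠ 0 → ∀ z, L y z y = - lam y z := by
    intro y hy z
    obtain ⟨v, hv⟩ := exe0 y hy
    have h1 := D4 y hy z y v v
    rw [D4c y hy, D4y y hy, ya y hy, hlam y hy z y v, hlam y hy z v v, lamy y hy, ya y hy,
      asym y hy z y, ya y hy] at h1
    have : (L y z y + lam y z) * D v (D v f) y = 0 := by linarith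
    linarith [(mul_eq_zero.1 this).resolve_right hv.ne']
  have hcex : ∀ y, ∃ c : ℝ, y ≠ 0 → ∀ z u, L y z u = lam y z * lam y u + c * D z (D u f) y := by
    intro y
    by_cases hy : y = 0
    · exact ⟨0, fun h => absurd hy h⟩
    let B : E n →ₗ[ℝ] E n →ₗ[ℝ] ℝ := LinearMap.mk₂ ℝ (fun z u => L y z u - lam y z * lam y u)
      (fun z z' u => by simp only [L_add1, map_add]; ring)
      (fun c z u => by simp only [L_smul1, map_smul, smul_eq_mul]; ring)
      (fun z u u' => by simp only [L_add2 y hy, map_add]; ring)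
      (fun c z u => by simp only [L_smul2 y hy, map_smul, smul_eq_mul]; ring)
    obtain ⟨v, hv⟩ := exe0 y hy
    obtain ⟨c, hc⟩ := Bca (Hs f hs y hy) B y v (fun u v => asym y hy u v) (fun u => ay y hy u)
      hv (hconv y hy) (fun u => by simp only [B, LinearMap.mk₂_apply, Ly y hy, lamy y hy]; ring)
      (fun z u v w => by
        simp only [B, LinearMap.mk₂_apply, Hs_apply]
        have h1 := D4 y hy z u v w
        have h2 := D4 y hy u z v w
        rw [D4c y hy z u, h2] at h1
        simp only [hlam y hy, asym y hy u z] at h1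
        linarith)
    refine ⟨c, fun _ z u => ?_⟩
    have := hc z u
    simp only [B, LinearMap.mk₂_apply, Hs_apply] at this
    linarith
  choose c hc using hcex
  have sc : Sm (O n) c := by
    refine Sm_of_local fun y hy => ?_
    obtain ⟨w, hw⟩ := exe0 y hy
    refine ⟨fun z => D w (fun y => lam y w) z - lam z w * lam z w, fun z => D w (D w f) z,
      ((slam w).D hO w).sub ((slam w).mul (slam w)), s2 _ _, hw.ne', ?_⟩
    intro z hz hA
    have h1 := hc z hz w w
    simp only [hL] at h1
    beta_reduce at hA ⊢
    rw [h1, eq_mul_inv_iff_mul_eq₀ hA]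
    ring
  have dc : ∀ y, y ≠ 0 → ∀ w, D w c y = c y * lam y w := by
    intro y hy
    have D2L : ∀ w z u, D w (D z (fun y' => lam y' u)) y =
        (lam y z * L y w u + lam y u * L y w z) +
        (c y * D w (D z (D u f)) y + D z (D u f) y * D w c y) := by
      intro w z u
      rw [D_congr hO hy (fun y hy => hc y hy z u) w,
        D_add (((slam z).mul (slam u)).diffAt hO hy) ((sc.mul (s2 z u)).diffAt hO hy),
        D_mul ((slam z).diffAt hO hy) ((slam u).diffAt hO hy),
        D_mul (sc.diffAt hO hy) ((s2 z u).diffAt hO hy)]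
    have key : ∀ w z u, (D w c y - c y * lam y w) * D z (D u f) y
        = (D z c y - c y * lam y z) * D w (D u f) y := by
      intro w z u
      have h1 := D2L w z u
      have h2 := D2L z w u
      rw [D_comm (slam u) hO hy, h2] at h1
      simp only [hc y hy, T12 y hy z w, asym y hy z w] at h1
      linarith
    intro w
    obtain ⟨z, hz, hz2⟩ := exe y hy (Hs f hs y hy w)
    rw [Hs_apply] at hz
    have h := key w z z
    rw [hz, mul_zero] at h
    linarith [(mul_eq_zero.1 h).resolve_right hz2.ne']
  have cne : ∀ y, y ≠ 0 → c y ≠ 0 := by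
    intro y hy h0
    have hzero : ∀ v, (∀ s : ℝ, v ≠ s • y) → lam y v = 0 := by
      intro v hv
      have hne : ∀ t : ℝ, y + t • v ≠ 0 := by
        intro t ht
        by_cases h : t = 0
        · simp [h] at ht; exact hy ht
        · apply hv (-t⁻¹)
          have : t • v = -y := by rw [eq_neg_iff_add_eq_zero, add_comm]; exact ht
          rw [neg_smul, ← smul_neg, ← this, smul_smul, inv_mul_cancel₀ h, one_smul]
      have hA : ∀ t : ℝ, 0 < D v (D v f) (y + t • v) := by
        intro t
        refine (hconv _ (hne t) v).resolve_left ?_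
        rintro ⟨s, hs'⟩
        have h6 : s • y = (1 - s * t) • v := by
          have h5 : v = s • y + (s * t) • v := by
            conv_lhs => rw [hs']
            module
          rw [sub_smul, one_smul]; exact eq_sub_of_add_eq h5.symm
        by_cases h : 1 - s * t = 0
        · have h2 : s • y = 0 := by
            rw [h6, h, zero_smul]
          rcases smul_eq_zero.1 h2 with h3 | h3
          · rw [h3] at h; norm_num at h
          · exact hy h3
        · apply hv ((1 - s * t)⁻¹ * s)
          rw [mul_smul, h6, smul_smul, inv_mul_cancel₀ h, one_smul]
      have dA : ∀ t : ℝ, HasDerivAt (fun t : ℝ => D v (D v f) (y + t • v))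
          (3 * lam (y + t • v) v * D v (D v f) (y + t • v)) t := by
        intro t
        have h := line_deriv (s2 v v) (hne t)
        rw [hlam _ (hne t)] at h
        convert h using 1; ring
      have dcl : ∀ t : ℝ, HasDerivAt (fun t : ℝ => c (y + t • v))
          (c (y + t • v) * lam (y + t • v) v) t := by
        intro t
        have h := line_deriv sc (hne t)
        rwa [dc _ (hne t)] at h
      have cubic : ∀ p : ℝ → ℝ, (∀ t, HasDerivAt p (p t * lam (y + t • v) v) t) → ∀ t,
          p t ^ 3 * (D v (D v f) (y + t • v))⁻¹ = p 0 ^ 3 * (D v (D v f) (y + (0:ℝ) • v))⁻¹ := by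
        intro p hp t
        have hd : ∀ t, HasDerivAt (fun t => p t ^ 3 * (D v (D v f) (y + t • v))⁻¹) 0 t := by
          intro t
          have h := ((hp t).fun_pow 3).fun_mul ((dA t).fun_inv (hA t).ne')
          refine h.congr_deriv ?_
          have := (hA t).ne'
          push_cast
          field_simp
          ring
        exact is_const_of_deriv_eq_zero (fun t => (hd t).differentiableAt)
          (fun t => (hd t).deriv) t 0
      have c0 : ∀ t : ℝ, c (y + t • v) = 0 := by
        intro t
        have h := cubic _ dcl t
        simp only [zero_smul, add_zero, h0] at h
        have h2 := inv_ne_zero (hA t).ne'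
        have h3 : c (y + t • v) ^ 3 * (D v (D v f) (y + t • v))⁻¹ = 0 := by rw [h]; simp
        exact pow_eq_zero_iff (by norm_num) |>.1 ((mul_eq_zero.1 h3).resolve_right h2)
      have dl : ∀ t : ℝ, HasDerivAt (fun t : ℝ => lam (y + t • v) v)
          (lam (y + t • v) v * lam (y + t • v) v) t := by
        intro t
        have h := line_deriv (slam v) (hne t)
        have h2 := hc _ (hne t) v v
        simp only [hL] at h2
        rw [h2, c0 t, zero_mul, add_zero] at h
        exact h
      have hl := cubic _ dl
      by_contra hlne
      have hln : ∀ t : ℝ, lam (y + t • v) v ≠ 0 := by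
        intro t ht
        have h := hl t
        rw [ht] at h
        have h2 := inv_ne_zero (hA 0).ne'
        have h3 : lam (y + (0:ℝ) • v) v ^ 3 * (D v (D v f) (y + (0:ℝ) • v))⁻¹ = 0 := by
          rw [← h]; simp
        have := pow_eq_zero_iff (by norm_num) |>.1 ((mul_eq_zero.1 h3).resolve_right h2)
        apply hlne; simpa using this
      have hd : ∀ t, HasDerivAt (fun t : ℝ => (lam (y + t • v) v)⁻¹ + t) 0 t := by
        intro t
        have h := ((dl t).fun_inv (hln t)).fun_add (hasDerivAt_id t)
        refine h.congr_deriv ?_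
        have := hln t
        field_simp
        ring
      have hconst := is_const_of_deriv_eq_zero (fun t => (hd t).differentiableAt)
          (fun t => (hd t).deriv) (lam y v)⁻¹ 0
      simp at hconst
      exact hln _ hconst
    obtain ⟨z, hz⟩ : ∃ z, ∀ s : ℝ, z ≠ s • y := by
      obtain ⟨z, -, hz⟩ := exists_indep hn (y := y) 0; exact ⟨z, hz⟩
    have h1 := hzero z hz
    have h2 := hzero (y + z) (by
      intro s hs
      apply hz (s - 1)
      rw [sub_smul, one_smul, ← hs]; abel)
    rw [map_add, h1, lamy y hy] at h2
    norm_num at h2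
  exact riem_part hn hs hpos hhom lam c hlam lamy slam sc cne hc dc
end Randers

/-! ### The division lemma -/

lemma poly5 {c0 c1 c2 c3 c4 c5 : ℝ}
    (h : ∀ t : ℝ, c0 + c1 * t + c2 * t ^ 2 + c3 * t ^ 3 + c4 * t ^ 4 + c5 * t ^ 5 = 0) :
    c0 = 0 ∧ c1 = 0 ∧ c2 = 0 ∧ c3 = 0 ∧ c4 = 0 ∧ c5 = 0 := by
  have h0 := h 0
  have h1 := h 1
  have h2 := h (-1)
  have h3 := h 2
  have h4 := h (-2)
  have h5 := h 3
  norm_num at h0 h1 h2 h3 h4 h5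
  refine ⟨?_, ?_, ?_, ?_, ?_, ?_⟩ <;> linarith

lemma dense_poly (p0 p1 p2 p3 p4 : ℝ) (h : p4 ≠ 0) :
    Dense {t : ℝ | p0 + p1 * t + p2 * t ^ 2 + p3 * t ^ 3 + p4 * t ^ 4 ≠ 0} := by
  classical
  let P : Polynomial ℝ := Polynomial.C p0 + Polynomial.C p1 * Polynomial.X
    + Polynomial.C p2 * Polynomial.X ^ 2 + Polynomial.C p3 * Polynomial.X ^ 3
    + Polynomial.C p4 * Polynomial.X ^ 4
  have hP : P ≠ 0 := by
    intro h0
    have : P.coeff 4 = p4 := by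
      simp [P, Polynomial.coeff_X, Polynomial.coeff_C]
    rw [h0] at this
    exact h (by simpa using this.symm)
  have hfin : ({t : ℝ | P.IsRoot t}).Finite := Polynomial.finite_setOf_isRoot hP
  have hd := hfin.countable.dense_compl ℝ
  refine hd.mono ?_
  intro t ht h0
  apply ht
  simp only [Set.mem_setOf_eq, Polynomial.IsRoot.def, P]
  simpa using h0

/-- functions that are cubic polynomials along affine lines. -/
def IsCubic {V : Type*} [AddCommGroup V] [Module ℝ V] (S : V → ℝ) : Prop :=
  ∀ e x : V, ∃ s0 s1 s2 s3 : ℝ, ∀ t : ℝ,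
    S (t • e + x) = s3 + s2 * t + s1 * t ^ 2 + s0 * t ^ 3

section Cubic
variable {V : Type*} [AddCommGroup V] [Module ℝ V]

lemma IsCubic.add {S S' : V → ℝ} (h : IsCubic S) (h' : IsCubic S') :
    IsCubic (fun v => S v + S' v) := by
  intro e x
  obtain ⟨a0, a1, a2, a3, ha⟩ := h e x
  obtain ⟨b0, b1, b2, b3, hb⟩ := h' e x
  refine ⟨a0 + b0, a1 + b1, a2 + b2, a3 + b3, fun t => ?_⟩
  simp only [ha t, hb t]; ring

lemma IsCubic.sum {ι : Type*} (s : Finset ι) {S : ι → V → ℝ} (h : ∀ i, IsCubic (S i)) :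
    IsCubic (fun v => ∑ i ∈ s, S i v) := by
  classical
  induction s using Finset.induction_on with
  | empty => intro e x; exact ⟨0, 0, 0, 0, fun t => by simp⟩
  | insert i s hi ih =>
    simp only [Finset.sum_insert hi]
    exact (h i).add ih

lemma IsCubic.prod (l1 l2 l3 : V →ₗ[ℝ] ℝ) : IsCubic (fun v => l1 v * l2 v * l3 v) := by
  intro e x
  refine ⟨l1 e * l2 e * l3 e, l1 e * l2 e * l3 x + l1 e * l2 x * l3 e + l1 x * l2 e * l3 e,
    l1 e * l2 x * l3 x + l1 x * l2 e * l3 x + l1 x * l2 x * l3 e, l1 x * l2 x * l3 x, fun t => ?_⟩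
  simp only [map_add, map_smul, smul_eq_mul]; ring

lemma division1 (a R : V →ₗ[ℝ] V →ₗ[ℝ] ℝ) (T : V →ₗ[ℝ] V →ₗ[ℝ] V →ₗ[ℝ] ℝ) (S : V → ℝ) (y e : V)
    (hsym : ∀ u v, a u v = a v u) (hay : ∀ u, a u y = 0) (he : a e e = 1)
    (hpos : ∀ v, (∃ s : ℝ, v = s • y) ∨ 0 < a v v)
    (Rsym : ∀ u v, R u v = R v u) (hRy : ∀ u, R u y = 0)
    (T12 : ∀ u v w, T u v w = T v u w) (T23 : ∀ u v w, T u v w = T u w v)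
    (hS : IsCubic S) (hSR : ∀ v, S v * a v v = R v v * T v v v)
    (hnp : ¬ ∃ κ : ℝ, ∀ v, R v v = κ * a v v) (v : V) :
    T v v v = 3 * (T e e v - 2 / 3 * T e e e * a e v) * a v v := by
  -- basic equations
  have base : ∀ x, a e x = 0 →
      ((R x x - R e e * a x x) ^ 2 + 4 * a x x * R e x ^ 2) * (3 * T e x x - T e e e * a x x) = 0 ∧
      ((R x x - R e e * a x x) ^ 2 + 4 * a x x * R e x ^ 2) * (T x x x - 3 * T e e x * a x x) = 0
      := by
    intro x hx
    have hx' : a x e = 0 := by rw [hsym, hx]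
    obtain ⟨s0, s1, s2, s3, hs⟩ := hS e x
    have hT : ∀ t : ℝ, T (t • e + x) (t • e + x) (t • e + x) =
        T e e e * t ^ 3 + 3 * T e e x * t ^ 2 + 3 * T e x x * t + T x x x := by
      intro t
      simp only [map_add, map_smul, LinearMap.add_apply, LinearMap.smul_apply, smul_eq_mul]
      rw [T23 e x e, T12 x e e, T23 e x e, T23 x x e, T12 x e x]
      ring
    have hR : ∀ t : ℝ, R (t • e + x) (t • e + x) = R e e * t ^ 2 + 2 * R e x * t + R x x := by
      intro t
      simp only [map_add, map_smul, LinearMap.add_apply, LinearMap.smul_apply, smul_eq_mul]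
      rw [Rsym x e]; ring
    have ha : ∀ t : ℝ, a (t • e + x) (t • e + x) = t ^ 2 + a x x := by
      intro t
      simp only [map_add, map_smul, LinearMap.add_apply, LinearMap.smul_apply, smul_eq_mul, hx, hx',
        he]
      ring
    have hp := fun t : ℝ => hSR (t • e + x)
    simp only [hT, hR, ha, hs] at hp
    generalize T e e e = A at *
    generalize T e e x = B at *
    generalize T e x x = C at *
    generalize T x x x = D at *
    generalize a x x = s at *
    generalize R e e = r at *
    generalize R e x = p at *
    generalize R x x = q at *
    obtain ⟨h0, h1, h2, h3, h4, h5⟩ := poly5 (c0 := s3 * s - q * D)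
      (c1 := s2 * s - 2 * p * D - q * (3 * C)) (c2 := s3 + s1 * s - r * D - 2 * p * (3 * C) - q * (3 * B))
      (c3 := s2 + s0 * s - r * (3 * C) - 2 * p * (3 * B) - q * A) (c4 := s1 - r * (3 * B) - 2 * p * A)
      (c5 := s0 - r * A) (fun t => by linear_combination hp t)
    have e0 : s0 = r * A := by linarith
    have e1 : s1 = r * (3 * B) + 2 * p * A := by linarith
    have e2 : s2 = r * (3 * C) + 2 * p * (3 * B) + q * A - r * A * s := by
      rw [e0] at h3; linarith
    have e3 : s3 = r * D + 2 * p * (3 * C) + q * (3 * B) - (r * (3 * B) + 2 * p * A) * s := by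
      rw [e1] at h2; linarith
    have E1 : (3 * C - A * s) * (q - r * s) + 2 * p * (D - 3 * B * s) = 0 := by
      rw [e2] at h1; linear_combination -h1
    have E2 : (D - 3 * B * s) * (q - r * s) - 2 * s * p * (3 * C - A * s) = 0 := by
      rw [e3] at h0; linear_combination -h0
    constructor
    · linear_combination (q - r * s) * E1 - 2 * p * E2
    · linear_combination (q - r * s) * E2 + 2 * s * p * E1
  -- a good vector
  obtain ⟨x0, hx0, hgood⟩ : ∃ x0, a e x0 = 0 ∧
      (R x0 x0 - R e e * a x0 x0) ^ 2 + 4 * a x0 x0 * R e x0 ^ 2 ≠ 0 := by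
    by_contra hcon
    push Not at hcon
    apply hnp
    refine ⟨R e e, fun v => ?_⟩
    have hx : a e (v - a e v • e) = 0 := by simp [he]
    have h1 := hcon _ hx
    have hapos : 0 ≤ a (v - a e v • e) (v - a e v • e) := by
      rcases hpos (v - a e v • e) with ⟨s, hs⟩ | h
      · rw [hs]; simp [hay]
      · exact h.le
    have hq : R (v - a e v • e) (v - a e v • e) = R e e * a (v - a e v • e) (v - a e v • e) := by
      have : (R (v - a e v • e) (v - a e v • e)
        - R e e * a (v - a e v • e) (v - a e v • e)) ^ 2 = 0 := by
        have := sq_nonneg (R e (v - a e v • e))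
        have := mul_nonneg hapos this
        nlinarith [sq_nonneg (R (v - a e v • e) (v - a e v • e)
          - R e e * a (v - a e v • e) (v - a e v • e))]
      have := pow_eq_zero_iff (by norm_num) |>.1 this
      linarith
    have hp : R e (v - a e v • e) = 0 := by
      rcases hpos (v - a e v • e) with ⟨s, hs⟩ | h
      · rw [hs]; simp [hRy]
      · rw [hq] at h1
        have : a (v - a e v • e) (v - a e v • e) * R e (v - a e v • e) ^ 2 = 0 := by linarith
        exact pow_eq_zero_iff (by norm_num) |>.1 ((mul_eq_zero.1 this).resolve_left h.ne')
    generalize hw : v - a e v • e = w at *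
    have hv : v = a e v • e + w := by rw [← hw]; abel
    generalize a e v = t at *
    subst hv
    have hx' : a w e = 0 := by rw [hsym, hx]
    simp only [map_add, map_smul, LinearMap.add_apply, LinearMap.smul_apply, smul_eq_mul, hx, hx',
        he, hp, Rsym w e, hq]
    ring
  -- all vectors
  have all : ∀ x, a e x = 0 →
      3 * T e x x - T e e e * a x x = 0 ∧ T x x x - 3 * T e e x * a x x = 0 := by
    intro x hx
    have horth : ∀ t : ℝ, a e (t • x0 + x) = 0 := fun t => by simp [hx, hx0]
    have ha : ∀ t : ℝ, a (t • x0 + x) (t • x0 + x) =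
        a x0 x0 * t ^ 2 + 2 * a x0 x * t + a x x := by
      intro t
      simp only [map_add, map_smul, LinearMap.add_apply, LinearMap.smul_apply, smul_eq_mul]
      rw [hsym x x0]; ring
    have hR : ∀ t : ℝ, R (t • x0 + x) (t • x0 + x) =
        R x0 x0 * t ^ 2 + 2 * R x0 x * t + R x x := by
      intro t
      simp only [map_add, map_smul, LinearMap.add_apply, LinearMap.smul_apply, smul_eq_mul]
      rw [Rsym x x0]; ring
    have hRe : ∀ t : ℝ, R e (t • x0 + x) = R e x0 * t + R e x := by
      intro t
      simp only [map_add, map_smul, smul_eq_mul]; ring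
    have hTe : ∀ t : ℝ, T e e (t • x0 + x) = T e e x0 * t + T e e x := by
      intro t
      simp only [map_add, map_smul, smul_eq_mul]; ring
    have hT2 : ∀ t : ℝ, T e (t • x0 + x) (t • x0 + x) =
        T e x0 x0 * t ^ 2 + (T e x0 x + T e x x0) * t + T e x x := by
      intro t
      simp only [map_add, map_smul, LinearMap.add_apply, LinearMap.smul_apply, smul_eq_mul]; ring
    have hT3 : ∀ t : ℝ, T (t • x0 + x) (t • x0 + x) (t • x0 + x) =
        T x0 x0 x0 * t ^ 3 + (T x0 x0 x + T x0 x x0 + T x x0 x0) * t ^ 2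
        + (T x0 x x + T x x0 x + T x x x0) * t + T x x x := by
      intro t
      simp only [map_add, map_smul, LinearMap.add_apply, LinearMap.smul_apply, smul_eq_mul]; ring
    set m2 := R x0 x0 - R e e * a x0 x0 with hm2
    set m1 := 2 * R x0 x - R e e * (2 * a x0 x) with hm1
    set m0 := R x x - R e e * a x x with hm0
    have hd := dense_poly (m0 ^ 2 + 4 * a x x * R e x ^ 2)
      (2 * m0 * m1 + 4 * (a x x * (2 * R e x0 * R e x) + 2 * a x0 x * R e x ^ 2))
      (m1 ^ 2 + 2 * m0 * m2 + 4 * (a x x * R e x0 ^ 2 + 2 * a x0 x * (2 * R e x0 * R e x)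
        + a x0 x0 * R e x ^ 2))
      (2 * m1 * m2 + 4 * (2 * a x0 x * R e x0 ^ 2 + a x0 x0 * (2 * R e x0 * R e x)))
      (m2 ^ 2 + 4 * a x0 x0 * R e x0 ^ 2) hgood
    have ev : ∀ t : ℝ, (R (t • x0 + x) (t • x0 + x) - R e e * a (t • x0 + x) (t • x0 + x)) ^ 2
        + 4 * a (t • x0 + x) (t • x0 + x) * R e (t • x0 + x) ^ 2 =
        (m0 ^ 2 + 4 * a x x * R e x ^ 2) +
      (2 * m0 * m1 + 4 * (a x x * (2 * R e x0 * R e x) + 2 * a x0 x * R e x ^ 2)) * t +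
      (m1 ^ 2 + 2 * m0 * m2 + 4 * (a x x * R e x0 ^ 2 + 2 * a x0 x * (2 * R e x0 * R e x)
        + a x0 x0 * R e x ^ 2)) * t ^ 2 +
      (2 * m1 * m2 + 4 * (2 * a x0 x * R e x0 ^ 2 + a x0 x0 * (2 * R e x0 * R e x))) * t ^ 3 +
      (m2 ^ 2 + 4 * a x0 x0 * R e x0 ^ 2) * t ^ 4 := by
      intro t
      rw [ha, hR, hRe, hm0, hm1, hm2]; ring
    constructor
    · have hz : (fun t : ℝ => 3 * T e (t • x0 + x) (t • x0 + x)
          - T e e e * a (t • x0 + x) (t • x0 + x)) = fun _ => 0 := by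
        refine Continuous.ext_on hd ?_ continuous_const ?_
        · simp only [hT2, ha]; fun_prop
        · intro t ht
          have h := (base _ (horth t)).1
          rw [ev] at h
          exact (mul_eq_zero.1 h).resolve_left ht
      simpa using congrFun hz 0
    · have hz : (fun t : ℝ => T (t • x0 + x) (t • x0 + x) (t • x0 + x)
          - 3 * T e e (t • x0 + x) * a (t • x0 + x) (t • x0 + x)) = fun _ => 0 := by
        refine Continuous.ext_on hd ?_ continuous_const ?_
        · simp only [hT3, hTe, ha]; fun_prop
        · intro t ht
          have h := (base _ (horth t)).2
          rw [ev] at h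
          exact (mul_eq_zero.1 h).resolve_left ht
      simpa using congrFun hz 0
  have hx : a e (v - a e v • e) = 0 := by simp [he]
  obtain ⟨k1, k2⟩ := all _ hx
  generalize hw : v - a e v • e = w at *
  have hv : v = a e v • e + w := by rw [← hw]; abel
  generalize a e v = t at *
  subst hv
  have hx' : a w e = 0 := by rw [hsym, hx]
  simp only [map_add, map_smul, LinearMap.add_apply, LinearMap.smul_apply, smul_eq_mul, hx, hx', he]
  rw [T23 e w e, T12 w e e, T23 e w e, T23 w w e, T12 w e w]
  linear_combination t * k1 + k2

/-- The division lemma without normalization. -/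
lemma division2 (a R : V →ₗ[ℝ] V →ₗ[ℝ] ℝ) (T : V →ₗ[ℝ] V →ₗ[ℝ] V →ₗ[ℝ] ℝ) (S : V → ℝ) (y e : V)
    (hsym : ∀ u v, a u v = a v u) (hay : ∀ u, a u y = 0)
    (hpos : ∀ v, (∃ s : ℝ, v = s • y) ∨ 0 < a v v)
    (Rsym : ∀ u v, R u v = R v u) (hRy : ∀ u, R u y = 0)
    (T12 : ∀ u v w, T u v w = T v u w) (T23 : ∀ u v w, T u v w = T u w v)
    (hS : IsCubic S) (hSR : ∀ v, S v * a v v = R v v * T v v v)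
    (hnp : ¬ ∃ κ : ℝ, ∀ v, R v v = κ * a v v) (v : V) :
    a e e ^ 2 * T v v v = 3 * (a e e * T e e v - 2 / 3 * T e e e * a e v) * a v v := by
  rcases hpos e with ⟨s, hs⟩ | he
  · have h1 : ∀ u, a e u = 0 := fun u => by rw [hsym, hs]; simp [hay]
    simp [h1]
  · have hr : 0 < Real.sqrt (a e e) := Real.sqrt_pos.2 he
    have hrr : Real.sqrt (a e e) * Real.sqrt (a e e) = a e e := Real.mul_self_sqrt he.le
    generalize Real.sqrt (a e e) = r at *
    have h := division1 a R T S y (r⁻¹ • e) hsym hay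
      (by simp only [map_smul, LinearMap.smul_apply, smul_eq_mul]; rw [← hrr]; field_simp)
      hpos Rsym hRy T12 T23 hS hSR hnp v
    simp only [map_smul, LinearMap.smul_apply, smul_eq_mul] at h
    rw [h, ← hrr]
    field_simp

/-- Polarization. -/
lemma polarize (a : V →ₗ[ℝ] V →ₗ[ℝ] ℝ) (T : V →ₗ[ℝ] V →ₗ[ℝ] V →ₗ[ℝ] ℝ) (l : V →ₗ[ℝ] ℝ)
    (hsym : ∀ u v, a u v = a v u)
    (T12 : ∀ u v w, T u v w = T v u w) (T23 : ∀ u v w, T u v w = T u w v)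
    (h : ∀ v, T v v v = 3 * l v * a v v) (u v w : V) :
    T u v w = l u * a v w + l v * a u w + l w * a u v := by
  have h1 := h u
  have h2 := h v
  have h3 := h w
  have h4 := h (u + v)
  have h5 := h (u + w)
  have h6 := h (v + w)
  have h7 := h (u + v + w)
  simp only [map_add, LinearMap.add_apply] at h4 h5 h6 h7
  have e1 : T u w v = T u v w := T23 _ _ _
  have e2 : T v u w = T u v w := T12 _ _ _
  have e3 : T v w u = T u v w := by rw [T23, T12]
  have e4 : T w u v = T u v w := by rw [T12, T23]
  have e5 : T w v u = T u v w := by rw [T23, T12, T23]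
  have f1 := hsym v u
  have f2 := hsym w u
  have f3 := hsym w v
  rw [e1, e2, e3, e4, e5, f1, f2, f3] at h7
  rw [f1] at h4
  rw [f2] at h5
  rw [f3] at h6
  linear_combination (1/6) * (h7 - h4 - h5 - h6 + h1 + h2 + h3)

end Cubic

/-! ### Geometry of the fibre -/
section Fibre
variable {n : ℕ} {U : Set (E n)} {F : E n → E n → ℝ} {x y : E n}

lemma smF (hF : IsFinsler n U F) (hx : x ∈ U) : Sm (O n) (F x) := (smo_F hF).fiber hx

lemma homF (hF : IsFinsler n U F) (hx : x ∈ U) : Hom 1 (F x) := by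
  intro y hy c hc
  rw [zpow_one]; exact hF.homog x hx y hy c hc

lemma gm_eq (hF : IsFinsler n U F) (hx : x ∈ U) (hy : y ≠ 0) (i j : Fin n) :
    gm n F i j x y = D (e n i) (F x) y * D (e n j) (F x) y
      + F x y * D (e n i) (D (e n j) (F x)) y := by
  have hs := smF hF hx
  have hO := isOpen_O (n := n)
  have h0 : gm n F i j x y = (1/2 : ℝ) * D (e n i) (D (e n j) (fun y => F x y ^ 2)) y := rfl
  have h1 : ∀ y : E n, y ≠ 0 → D (e n j) (fun y => F x y ^ 2) y
      = 2 * (F x y * D (e n j) (F x) y) := by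
    intro y hy
    have : (fun y => F x y ^ 2) = fun y => F x y * F x y := by funext y; ring
    rw [this, D_mul (hs.diffAt hO hy) (hs.diffAt hO hy)]; ring
  rw [h0, D_congr hO hy h1, D_const_mul ((hs.mul (hs.D hO _)).diffAt hO hy),
    D_mul (hs.diffAt hO hy) ((hs.D hO _).diffAt hO hy)]
  ring

lemma hm_eq (hF : IsFinsler n U F) (hx : x ∈ U) (hy : y ≠ 0) (i j : Fin n) :
    hm n F i j x y = F x y * D (e n i) (D (e n j) (F x)) y := by
  have : hm n F i j x y = gm n F i j x y - D (e n i) (F x) y * D (e n j) (F x) y := rfl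
  rw [this, gm_eq hF hx hy]; ring

lemma Hs_sum (hF : IsFinsler n U F) (hx : x ∈ U) (hy : y ≠ 0) (v : E n) :
    ∑ j, ∑ k, hm n F j k x y * v j * v k = F x y * D v (D v (F x)) y := by
  have h := bilin_expand (Hs (F x) (smF hF hx) y hy) v v
  simp only [Hs_apply] at h
  rw [h, Finset.mul_sum]
  refine Finset.sum_congr rfl fun i _ => ?_
  rw [Finset.mul_sum]
  refine Finset.sum_congr rfl fun j _ => ?_
  rw [hm_eq hF hx hy]; ring

lemma yH (hF : IsFinsler n U F) (hx : x ∈ U) (hy : y ≠ 0) (v : E n) :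
    D v (D y (F x)) y = 0 := by
  rw [D_comm (smF hF hx) isOpen_O hy]
  simpa using ((homF hF hx).D (smF hF hx) v).euler ((smF hF hx).D isOpen_O v) hy

lemma convF (hF : IsFinsler n U F) (hx : x ∈ U) (hy : y ≠ 0) (v : E n) :
    (∃ s : ℝ, v = s • y) ∨ 0 < D v (D v (F x)) y := by
  by_cases hv : ∃ s : ℝ, v = s • y
  · exact Or.inl hv
  right
  have hs := smF hF hx
  have hp := hF.pos x hx y hy
  set w : E n := v - (D v (F x) y / F x y) • y with hw
  have hw0 : w ≠ 0 := fun h => hv ⟨_, sub_eq_zero.1 h⟩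
  have h1 := (hF.posdef x hx y hy).dotProduct_mulVec_pos hw0
  have h2 : star w ⬝ᵥ ((gmat n F x y).mulVec w) =
      D w (F x) y * D w (F x) y + F x y * D w (D w (F x)) y := by
    have e1 := lin_expand (fderiv ℝ (F x) y).toLinearMap w
    have e1' : D w (F x) y = ∑ i, D (e n i) (F x) y * w i := e1
    rw [← Hs_sum hF hx hy w, e1', star_trivial,
      Finset.sum_mul_sum, ← Finset.sum_add_distrib]
    simp only [dotProduct, Matrix.mulVec, Finset.mul_sum]
    refine Finset.sum_congr rfl fun i _ => ?_
    rw [← Finset.sum_add_distrib]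
    refine Finset.sum_congr rfl fun j _ => ?_
    have : gmat n F x y i j = gm n F i j x y := rfl
    rw [this, hm_eq hF hx hy, gm_eq hF hx hy]; ring
  have h3 : D w (F x) y = 0 := by
    have e2 : D y (F x) y = F x y := by simpa using (homF hF hx).euler hs hy
    have e3 : D w (F x) y = D v (F x) y - (D v (F x) y / F x y) * D y (F x) y := by
      rw [hw]; simp [D]
    rw [e3, e2]; field_simp; ring
  have h4 : D w (D w (F x)) y = D v (D v (F x)) y := by
    simp only [← Hs_apply hs y hy]
    have k1 : ∀ u, Hs (F x) hs y hy u y = 0 := fun u => yH hF hx hy u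
    have k2 : ∀ u, Hs (F x) hs y hy y u = 0 := fun u => by
      rw [Hs_apply, D_comm hs isOpen_O hy]; exact yH hF hx hy u
    simp [hw, k1, k2, -Hs_apply]
  rw [h2, h3, h4] at h1
  have : 0 < F x y * D v (D v (F x)) y := by linarith
  exact (mul_pos_iff_of_pos_left hp).1 this

/-- The curvature form. -/
def Rb (F : E n → E n → ℝ) (x y : E n) : E n →ₗ[ℝ] E n →ₗ[ℝ] ℝ :=
  LinearMap.mk₂ ℝ (fun u v => ∑ j, ∑ k, Rlow n F j k x y * u j * v k)
    (fun u u' v => by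
      simp only [Pi.add_apply, ← Finset.sum_add_distrib]
      exact Finset.sum_congr rfl fun i _ => Finset.sum_congr rfl fun j _ => by ring)
    (fun c u v => by
      simp only [Pi.smul_apply, smul_eq_mul, Finset.mul_sum]
      exact Finset.sum_congr rfl fun i _ => Finset.sum_congr rfl fun j _ => by ring)
    (fun u v v' => by
      simp only [Pi.add_apply, ← Finset.sum_add_distrib]
      exact Finset.sum_congr rfl fun i _ => Finset.sum_congr rfl fun j _ => by ring)
    (fun c u v => by
      simp only [Pi.smul_apply, smul_eq_mul, Finset.mul_sum]
      exact Finset.sum_congr rfl fun i _ => Finset.sum_congr rfl fun j _ => by ring)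

lemma Rb_apply (u v : E n) : Rb F x y u v = ∑ j, ∑ k, Rlow n F j k x y * u j * v k := rfl

lemma Rb_basis (j k : Fin n) : Rb F x y (e n j) (e n k) = Rlow n F j k x y := by
  simp [Rb_apply, e, Pi.single_apply]

lemma Rb_symm (hF : IsFinsler n U F) (hU : IsOpen U) (hx : x ∈ U) (hy : y ≠ 0) (u v : E n) :
    Rb F x y u v = Rb F x y v u := by
  rw [Rb_apply, Rb_apply, Finset.sum_comm]
  refine Finset.sum_congr rfl fun i _ => Finset.sum_congr rfl fun j _ => ?_
  rw [Rlow_symm hF hU hx hy]; ring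

lemma K_eq (hF : IsFinsler n U F) (hx : x ∈ U) (hy : y ≠ 0) (v : E n) :
    K n F x y v = Rb F x y v v / (F x y ^ 3 * D v (D v (F x)) y) := by
  unfold K
  rw [Hs_sum hF hx hy, Rb_apply]
  congr 1; ring

lemma LI_iff {y v : E n} (hy : y ≠ 0) :
    LinearIndependent ℝ ![y, v] ↔ ∀ s : ℝ, v ≠ s • y := by
  rw [LinearIndependent.pair_iff' hy]
  exact forall_congr' fun s => ne_comm

lemma Hpos (hF : IsFinsler n U F) (hx : x ∈ U) (hy : y ≠ 0) {v : E n} (h : ∀ s : ℝ, v ≠ s • y) :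
    0 < D v (D v (F x)) y :=
  (convF hF hx hy v).resolve_left (fun ⟨s, hs⟩ => h s hs)

lemma indep_add {y v : E n} (h : ∀ s : ℝ, v ≠ s • y) (t : ℝ) : ∀ s : ℝ, v + t • y ≠ s • y := by
  intro s hs
  apply h (s - t)
  rw [sub_smul, ← hs]; abel

lemma indep_base {y v : E n} (hy : y ≠ 0) (h : ∀ s : ℝ, v ≠ s • y) (t : ℝ) :
    y + t • v ≠ 0 ∧ LinearIndependent ℝ ![y + t • v, v] := by
  have h1 := (LI_iff hy).2 h
  have h2 : LinearIndependent ℝ ![y + t • v, v] := by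
    rw [LinearIndependent.pair_iff] at h1 ⊢
    intro a b hab
    have := h1 a (a * t + b) (by rw [← hab]; module)
    refine ⟨this.1, ?_⟩
    have h3 := this.2
    rw [this.1] at h3; simpa using h3
  exact ⟨h2.ne_zero 0, h2⟩

lemma indep_symm {y v : E n} (hy : y ≠ 0) (h : ∀ s : ℝ, v ≠ s • y) :
    v ≠ 0 ∧ ∀ s : ℝ, y ≠ s • v := by
  have hv : v ≠ 0 := by simpa using h 0
  exact ⟨hv, (LI_iff hv).1 (LinearIndependent.pair_symm_iff.1 ((LI_iff hy).2 h))⟩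

lemma span_eq1 (y v : E n) (t : ℝ) :
    Submodule.span ℝ {y, v + t • y} = Submodule.span ℝ {y, v} := by
  apply le_antisymm <;> rw [Submodule.span_le] <;> intro z hz <;>
    rw [SetLike.mem_coe, Submodule.mem_span_pair] <;> rcases hz with rfl | rfl
  · exact ⟨1, 0, by simp⟩
  · exact ⟨t, 1, by module⟩
  · exact ⟨1, 0, by simp⟩
  · exact ⟨-t, 1, by module⟩

lemma K_swap (hF : IsFinsler n U F) (hsec : SectionalFlagCurv n U F) (hx : x ∈ U)
    {y v : E n} (hy : y ≠ 0) (h : ∀ s : ℝ, v ≠ s • y) : K n F x y v = K n F x v y :=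
  hsec x hx y v v y ((LI_iff hy).2 h) (LinearIndependent.pair_symm_iff.1 ((LI_iff hy).2 h))
    (by rw [Set.pair_comm])

lemma Rb_y (hF : IsFinsler n U F) (hU : IsOpen U) (hsec : SectionalFlagCurv n U F) (hn : 3 ≤ n)
    (hx : x ∈ U) (hy : y ≠ 0) (v : E n) : Rb F x y v y = 0 := by
  have hs := smF hF hx
  have hp := hF.pos x hx y hy
  have key : ∀ v, (∀ s : ℝ, v ≠ s • y) → Rb F x y y y = 0 ∧ Rb F x y v y = 0 := by
    intro v hv
    have h : ∀ t : ℝ, Rb F x y (v + t • y) (v + t • y) = Rb F x y v v := by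
      intro t
      have hv' := indep_add hv t
      have h1 := hsec x hx y (v + t • y) y v ((LI_iff hy).2 hv') ((LI_iff hy).2 hv) (span_eq1 y v t)
      rw [K_eq hF hx hy, K_eq hF hx hy] at h1
      have h4 : D (v + t • y) (D (v + t • y) (F x)) y = D v (D v (F x)) y := by
        simp only [← Hs_apply hs y hy]
        have k1 : ∀ u, Hs (F x) hs y hy u y = 0 := fun u => yH hF hx hy u
        have k2 : ∀ u, Hs (F x) hs y hy y u = 0 := fun u => by
          rw [Hs_apply, D_comm hs isOpen_O hy]; exact yH hF hx hy u
        simp [k1, k2, -Hs_apply]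
      rw [h4] at h1
      have h5 := Hpos hF hx hy hv
      have h6 : F x y ^ 3 * D v (D v (F x)) y ≠ 0 := by positivity
      exact (div_left_inj' h6).1 h1
    have h1 := h 1
    have h2 := h (-1)
    simp only [map_add, map_smul, LinearMap.add_apply, LinearMap.smul_apply, smul_eq_mul,
      Rb_symm hF hU hx hy y v] at h1 h2
    constructor <;> linarith
  by_cases hv : ∃ s : ℝ, v = s • y
  · obtain ⟨s, rfl⟩ := hv
    obtain ⟨z, -, hz⟩ := exists_indep hn (y := y) 0
    simp [(key z hz).1]
  · push Not at hv
    exact (key v hv).2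

/-- Third derivative as a trilinear map. -/
def T3 (f : E n → ℝ) (hs : Sm (O n) f) (y : E n) (hy : y ≠ 0) :
    E n →ₗ[ℝ] E n →ₗ[ℝ] E n →ₗ[ℝ] ℝ :=
  LinearMap.mk₂ ℝ (fun u v => (fderiv ℝ (D u (D v f)) y).toLinearMap)
    (fun u u' v => by
      refine LinearMap.ext fun w => ?_
      have h1 : D (u + u') (D v f) = fun y => D u (D v f) y + D u' (D v f) y := by
        funext z; exact D_dir_add u u'
      have := D_add (((hs.D isOpen_O v).D isOpen_O u).diffAt isOpen_O hy)
        (((hs.D isOpen_O v).D isOpen_O u').diffAt isOpen_O hy) w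
      rw [h1]; exact this)
    (fun c u v => by
      refine LinearMap.ext fun w => ?_
      have h1 : D (c • u) (D v f) = fun y => c * D u (D v f) y := by
        funext z; exact D_dir_smul c u
      have := D_const_mul (((hs.D isOpen_O v).D isOpen_O u).diffAt isOpen_O hy) c w
      rw [h1]; exact this)
    (fun u v v' => by
      refine LinearMap.ext fun w => ?_
      have h1 := D_congr isOpen_O hy (fun z hz => D2_dir_add hs hz u v v') w
      rw [D_add (((hs.D isOpen_O v).D isOpen_O u).diffAt isOpen_O hy)
        (((hs.D isOpen_O v').D isOpen_O u).diffAt isOpen_O hy)] at h1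
      exact h1)
    (fun c u v => by
      refine LinearMap.ext fun w => ?_
      have h1 := D_congr isOpen_O hy (fun z hz => D2_dir_smul hs hz u c v) w
      rw [D_const_mul (((hs.D isOpen_O v).D isOpen_O u).diffAt isOpen_O hy)] at h1
      exact h1)

lemma T3_apply {f : E n → ℝ} (hs : Sm (O n) f) (y : E n) (hy : y ≠ 0) (u v w : E n) :
    T3 f hs y hy u v w = D w (D u (D v f)) y := rfl

lemma T3_12 {f : E n → ℝ} (hs : Sm (O n) f) (y : E n) (hy : y ≠ 0) (u v w : E n) :
    T3 f hs y hy u v w = T3 f hs y hy v u w :=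
  D_congr isOpen_O hy (fun z hz => D_comm hs isOpen_O hz u v) w

lemma T3_23 {f : E n → ℝ} (hs : Sm (O n) f) (y : E n) (hy : y ≠ 0) (u v w : E n) :
    T3 f hs y hy u v w = T3 f hs y hy u w v := by
  rw [T3_12, T3_12 hs y hy u w, T3_apply, T3_apply]
  rw [D_congr isOpen_O hy (fun z hz => D_comm hs isOpen_O hz v u) w,
    D_congr isOpen_O hy (fun z hz => D_comm hs isOpen_O hz w u) v,
    D_comm (hs.D isOpen_O v) isOpen_O hy w u, D_comm (hs.D isOpen_O w) isOpen_O hy v u]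
  exact D_congr isOpen_O hy (fun z hz => D_comm hs isOpen_O hz w v) u

/-- The derivative of the curvature form. -/
def Sd (F : E n → E n → ℝ) (x y v : E n) : ℝ :=
  ∑ j, ∑ k, (D v (Rlow n F j k x) y * v j * v k
    + (-3 / F x y * Rlow n F j k x y * D v (F x) y) * v j * v k)

lemma cubic_Sd : IsCubic (Sd F x y) := by
  refine IsCubic.sum _ fun j => IsCubic.sum _ fun k => IsCubic.add ?_ ?_
  · exact IsCubic.prod (fderiv ℝ (Rlow n F j k x) y).toLinearMap
      (LinearMap.proj j) (LinearMap.proj k)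
  · exact IsCubic.prod ((-3 / F x y * Rlow n F j k x y) • (fderiv ℝ (F x) y).toLinearMap)
      (LinearMap.proj j) (LinearMap.proj k)

lemma Sd_eq (hF : IsFinsler n U F) (hU : IsOpen U) (hsec : SectionalFlagCurv n U F) (hn : 3 ≤ n)
    (hx : x ∈ U) (hy : y ≠ 0) (v : E n) :
    Sd F x y v * D v (D v (F x)) y = Rb F x y v v * D v (D v (D v (F x))) y := by
  have hs := smF hF hx
  have hO := isOpen_O (n := n)
  by_cases hv : ∃ s : ℝ, v = s • y
  · obtain ⟨s, rfl⟩ := hv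
    have h1 : D (s • y) (D (s • y) (F x)) y = 0 := by
      rw [D2_dir_smul hs hy, yH hF hx hy, mul_zero]
    have h2 : Rb F x y (s • y) (s • y) = 0 := by
      rw [map_smul, Rb_y hF hU hsec hn hx hy]; simp
    rw [h1, h2]; ring
  push Not at hv
  have key : ∀ t : ℝ, Rb F x (y + t • v) v v * (F x y ^ 3 * D v (D v (F x)) y) =
      Rb F x y v v * (F x (y + t • v) ^ 3 * D v (D v (F x)) (y + t • v)) := by
    intro t
    obtain ⟨h0, h1⟩ := indep_base hy hv t
    have h2 := hsec x hx (y + t • v) v y v h1 ((LI_iff hy).2 hv) (by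
      have := span_eq1 v y t
      rw [Set.pair_comm, this, Set.pair_comm])
    rw [K_eq hF hx h0, K_eq hF hx hy] at h2
    have p1 := hF.pos x hx y hy
    have p2 := hF.pos x hx _ h0
    have p3 := Hpos hF hx hy hv
    have p4 := Hpos hF hx h0 ((LI_iff h0).1 h1)
    rwa [div_eq_div_iff (by positivity) (by positivity)] at h2
  have hne : y + (0:ℝ) • v ≠ 0 := by simpa using hy
  have d1 : HasDerivAt (fun t : ℝ => Rb F x (y + t • v) v v)
      (∑ j, ∑ k, D v (Rlow n F j k x) y * v j * v k) 0 := by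
    have : ∀ j k, HasDerivAt (fun t : ℝ => Rlow n F j k x (y + t • v) * v j * v k)
        (D v (Rlow n F j k x) y * v j * v k) 0 := by
      intro j k
      have h := line_deriv ((smo_Rlow hF hU j k).fiber hx) hne
      simp only [zero_smul, add_zero] at h
      exact (h.mul_const _).mul_const _
    simp only [Rb_apply]
    exact HasDerivAt.fun_sum fun j _ => HasDerivAt.fun_sum fun k _ => this j k
  have d2 := line_deriv hs hne
  have d3 := line_deriv ((hs.D hO v).D hO v) hne
  have e1 := d1.mul_const (F x y ^ 3 * D v (D v (F x)) y)
  have e2 := ((d2.fun_pow 3).fun_mul d3).const_mul (Rb F x y v v)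
  have e3 := e1.unique (e2.congr_of_eventuallyEq (Filter.Eventually.of_forall key))
  simp only [zero_smul, add_zero] at e3
  have hp := hF.pos x hx y hy
  have hSd : Sd F x y v = (∑ j, ∑ k, D v (Rlow n F j k x) y * v j * v k)
      + (-3 / F x y * D v (F x) y) * Rb F x y v v := by
    unfold Sd
    rw [Rb_apply, Finset.mul_sum, ← Finset.sum_add_distrib]
    refine Finset.sum_congr rfl fun j _ => ?_
    rw [Finset.mul_sum, ← Finset.sum_add_distrib]
    refine Finset.sum_congr rfl fun k _ => ?_
    ring
  rw [hSd]
  have hp3 : F x y ^ 3 ≠ 0 := by positivity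
  apply mul_left_cancel₀ hp3
  push_cast at e3
  field_simp
  field_simp at e3
  linear_combination e3

lemma nonpolar (hF : IsFinsler n U F) (hU : IsOpen U) (hx : x ∈ U) (hy : y ≠ 0)
    (h : ¬ IsPolarDir n F x y) :
    ¬ ∃ κ : ℝ, ∀ v, Rb F x y v v = κ * Hs (F x) (smF hF hx) y hy v v := by
  rintro ⟨κ, hk⟩
  apply h
  refine ⟨κ / F x y ^ 3, fun j k => ?_⟩
  have h1 := hk (e n j)
  have h2 := hk (e n k)
  have h3 := hk (e n j + e n k)
  have hp := hF.pos x hx y hy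
  simp only [map_add, LinearMap.add_apply, Rb_symm hF hU hx hy (e n k) (e n j)] at h3
  have h4 : Hs (F x) (smF hF hx) y hy (e n k) (e n j)
      = Hs (F x) (smF hF hx) y hy (e n j) (e n k) := D_comm (smF hF hx) isOpen_O hy _ _
  rw [h4] at h3
  have h5 : Rb F x y (e n j) (e n k) = κ * Hs (F x) (smF hF hx) y hy (e n j) (e n k) := by
    linarith
  rw [Rb_basis, Hs_apply] at h5
  rw [h5, hm_eq hF hx hy]
  field_simp

theorem null_case (hF : IsFinsler n U F) (hU : IsOpen U) (hsec : SectionalFlagCurv n U F)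
    (hn : 3 ≤ n) (hx : x ∈ U)
    (hnull : volume {y : E n | y ≠ 0 ∧ IsPolarDir n F x y} = 0) :
    ∃ (a : Matrix (Fin n) (Fin n) ℝ) (b : E n), a.IsSymm ∧ a.PosDef ∧
        (∑ i, ∑ j, a⁻¹ i j * b i * b j < 1) ∧
        ∀ y : E n, y ≠ 0 →
          F x y = Real.sqrt (∑ i, ∑ j, a i j * y i * y j) + ∑ i, b i * y i := by
  have hs := smF hF hx
  have hO := isOpen_O (n := n)
  have hsym : ∀ y (hy : y ≠ 0) u v, Hs (F x) hs y hy u v = Hs (F x) hs y hy v u :=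
    fun y hy u v => D_comm hs hO hy u v
  have hnp : ∀ y (hy : y ≠ 0), ¬ IsPolarDir n F x y → ∀ u v : E n,
      D u (D u (F x)) y ^ 2 * D v (D v (D v (F x))) y = 3 * (D u (D u (F x)) y *
        D v (D u (D u (F x))) y - 2 / 3 * D u (D u (D u (F x))) y * D u (D v (F x)) y)
        * D v (D v (F x)) y := by
    intro y hy hpol u v
    exact division2 (Hs (F x) hs y hy) (Rb F x y) (T3 (F x) hs y hy) (Sd F x y) y u
      (hsym y hy) (fun w => yH hF hx hy w) (fun w => convF hF hx hy w)
      (fun w z => Rb_symm hF hU hx hy w z) (fun w => Rb_y hF hU hsec hn hx hy w)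
      (T3_12 hs y hy) (T3_23 hs y hy) cubic_Sd (fun w => Sd_eq hF hU hsec hn hx hy w)
      (nonpolar hF hU hx hy hpol) v
  have hall : ∀ y : E n, y ≠ 0 → ∀ u v : E n,
      D u (D u (F x)) y ^ 2 * D v (D v (D v (F x))) y = 3 * (D u (D u (F x)) y *
        D v (D u (D u (F x))) y - 2 / 3 * D u (D u (D u (F x))) y * D u (D v (F x)) y)
        * D v (D v (F x)) y := by
    intro y0 hy0 u v
    by_contra hne
    have s2 := fun u v => (hs.D hO v).D hO u
    have s3 := fun u v w => (s2 v w).D hO u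
    have c2 : ∀ u v, ContinuousOn (D u (D v (F x))) (O n) := fun u v => (s2 u v).continuousOn
    have c3 : ∀ u v w, ContinuousOn (D u (D v (D w (F x)))) (O n) :=
      fun u v w => (s3 u v w).continuousOn
    have hg : ContinuousOn (fun y => D u (D u (F x)) y ^ 2 * D v (D v (D v (F x))) y
      - 3 * (D u (D u (F x)) y *
        D v (D u (D u (F x))) y - 2 / 3 * D u (D u (D u (F x))) y * D u (D v (F x)) y)
        * D v (D v (F x)) y) (O n) :=
      (((c2 u u).pow 2).mul (c3 v v v)).sub ((continuousOn_const.mul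
        (((c2 u u).mul (c3 v u u)).sub ((continuousOn_const.mul (c3 u u u)).mul (c2 u v)))).mul
        (c2 v v))
    have hop := hg.isOpen_inter_preimage hO (isOpen_ne (x := (0:ℝ)))
    have hpos := hop.measure_pos volume ⟨y0, hy0, sub_ne_zero.2 hne⟩
    have hsub : ¬ (O n ∩ (fun y => D u (D u (F x)) y ^ 2 * D v (D v (D v (F x))) y
      - 3 * (D u (D u (F x)) y *
        D v (D u (D u (F x))) y - 2 / 3 * D u (D u (D u (F x))) y * D u (D v (F x)) y)
        * D v (D v (F x)) y) ⁻¹' {y | y ≠ 0}) ⊆ {y : E n | y ≠ 0 ∧ IsPolarDir n F x y} := by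
      intro hsub
      exact hpos.ne' (measure_mono_null hsub hnull)
    rw [Set.not_subset] at hsub
    obtain ⟨y, ⟨hy, hy2⟩, hy3⟩ := hsub
    exact hy2 (sub_eq_zero.2 (hnp y hy (fun h => hy3 ⟨hy, h⟩) u v))
  refine randers_of_cred hn hs (hF.pos x hx) (homF hF hx) (fun y hy v => convF hF hx hy v) ?_
  intro y hy
  obtain ⟨z, -, hz⟩ := exists_indep hn (y := y) 0
  have hzp := Hpos hF hx hy hz
  let l : E n →ₗ[ℝ] ℝ := (D z (D z (F x)) y ^ 2)⁻¹ • (D z (D z (F x)) y • T3 (F x) hs y hy z z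
    - (2 / 3 * D z (D z (D z (F x))) y) • Hs (F x) hs y hy z)
  have hl : ∀ v, T3 (F x) hs y hy v v v = 3 * l v * Hs (F x) hs y hy v v := by
    intro v
    have h := hall y hy z v
    simp only [l, LinearMap.smul_apply, LinearMap.sub_apply, smul_eq_mul, T3_apply, Hs_apply]
    field_simp
    linear_combination h
  refine ⟨l, fun u v w => ?_⟩
  have h := polarize (Hs (F x) hs y hy) (T3 (F x) hs y hy) l (hsym y hy) (T3_12 hs y hy)
    (T3_23 hs y hy) hl v w u
  rw [T3_apply] at h
  simp only [Hs_apply] at h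
  rw [h, D_comm hs hO hy w u, D_comm hs hO hy v u]; ring

end Fibre

/-! ### The case of positive measure -/
section Positive
variable {n : ℕ} {U : Set (E n)} {F : E n → E n → ℝ} {x y : E n}

lemma quad_zero (B : E n →ₗ[ℝ] E n →ₗ[ℝ] ℝ) (h : 0 < volume {v : E n | B v v = 0}) (v : E n) :
    B v v = 0 := by
  by_contra hv
  have hc : Continuous (fun z : E n => B z z) := by
    have : (fun z : E n => B z z) = fun z => ∑ i, ∑ j, B (e n i) (e n j) * z i * z j := by
      funext z; exact bilin_expand B z z
    rw [this]; fun_prop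
  have hm : MeasurableSet {z : E n | B z z ≠ 0} := (isOpen_ne.preimage hc).measurableSet
  have hae : ∀ᵐ z : E n, z ∈ {z : E n | B z z ≠ 0} := by
    refine ae_mem_of_ae_add_linearMap_mem (LinearMap.toSpanSingleton ℝ (E n) v) volume volume hm ?_
    intro z
    classical
    let P : Polynomial ℝ := Polynomial.C (B z z) + Polynomial.C (B z v + B v z) * Polynomial.X
      + Polynomial.C (B v v) * Polynomial.X ^ 2
    have hP : P ≠ 0 := by
      intro h0
      have : P.coeff 2 = B v v := by
        simp [P, Polynomial.coeff_X, Polynomial.coeff_C]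
      rw [h0] at this
      exact hv (by simpa using this.symm)
    have hfin : ({t : ℝ | P.IsRoot t}).Finite := Polynomial.finite_setOf_isRoot hP
    have h0 : volume {t : ℝ | P.IsRoot t} = 0 := hfin.measure_zero _
    rw [ae_iff]
    refine measure_mono_null ?_ h0
    intro t ht
    simp only [Set.mem_setOf_eq, not_not, LinearMap.toSpanSingleton_apply, map_add, map_smul,
      LinearMap.add_apply, LinearMap.smul_apply, smul_eq_mul] at ht
    simp only [Set.mem_setOf_eq, Polynomial.IsRoot.def, P]
    simp only [Polynomial.eval_add, Polynomial.eval_mul, Polynomial.eval_C, Polynomial.eval_X,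
      Polynomial.eval_pow]
    linear_combination ht
  rw [ae_iff] at hae
  simp only [Set.mem_setOf_eq, not_not] at hae
  exact h.ne' hae

lemma line_null (hn : 3 ≤ n) (y : E n) : volume {v : E n | ∃ s : ℝ, v = s • y} = 0 := by
  have h : (Submodule.span ℝ {y} : Submodule ℝ (E n)) ≠ ⊤ := by
    intro ht
    obtain ⟨z, -, hz⟩ := exists_indep hn (y := y) 0
    have : z ∈ Submodule.span ℝ {y} := by rw [ht]; trivial
    obtain ⟨s, hs⟩ := Submodule.mem_span_singleton.1 this
    exact hz s hs.symm
  refine measure_mono_null ?_ (Measure.addHaar_submodule volume _ h)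
  rintro v ⟨s, rfl⟩
  exact Submodule.smul_mem _ _ (Submodule.mem_span_singleton_self y)

theorem positive_case (hF : IsFinsler n U F) (hsec : SectionalFlagCurv n U F)
    (hn : 3 ≤ n) (hx : x ∈ U)
    (hpos : 0 < volume {y : E n | y ≠ 0 ∧ IsPolarDir n F x y}) : IsotropicAt n F x := by
  set P := {y : E n | y ≠ 0 ∧ IsPolarDir n F x y} with hP
  have off : ∀ y : E n, 0 < volume (P \ {v : E n | ∃ s : ℝ, v = s • y}) := by
    intro y
    rw [measure_sdiff_null (line_null hn y)]; exact hpos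
  have hpol : ∀ y ∈ P, ∃ κ : ℝ, ∀ v : E n, (∀ s : ℝ, v ≠ s • y) → K n F x y v = κ := by
    rintro y ⟨hy, κ, hk⟩
    refine ⟨κ, fun v hv => ?_⟩
    have p1 := hF.pos x hx y hy
    have p2 := Hpos hF hx hy hv
    rw [K_eq hF hx hy, div_eq_iff (by positivity)]
    have h := Hs_sum hF hx hy v
    rw [Rb_apply]
    have : ∑ j, ∑ k, Rlow n F j k x y * v j * v k
        = κ * F x y ^ 2 * ∑ j, ∑ k, hm n F j k x y * v j * v k := by
      rw [Finset.mul_sum]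
      refine Finset.sum_congr rfl fun j _ => ?_
      rw [Finset.mul_sum]
      refine Finset.sum_congr rfl fun k _ => ?_
      rw [hk]; ring
    rw [this, h]; ring
  choose! κ hκ using hpol
  have two : ∀ y ∈ P, ∀ z ∈ P, (∀ s : ℝ, z ≠ s • y) → κ y = κ z := by
    intro y hy z hz h
    rw [← hκ y hy z h, ← hκ z hz y (indep_symm hy.1 h).2]
    exact K_swap hF hsec hx hy.1 h
  obtain ⟨y1, hy1⟩ : P.Nonempty := nonempty_of_measure_ne_zero hpos.ne'
  have hconst : ∀ z ∈ P, κ z = κ y1 := by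
    intro z hz
    obtain ⟨w, hw, hw2⟩ := nonempty_of_measure_ne_zero (off y1).ne'
    by_cases h : ∃ s : ℝ, z = s • y1
    · obtain ⟨s, rfl⟩ := h
      rw [two y1 hy1 w hw (fun s hs => hw2 ⟨s, hs⟩)]
      refine two _ hz w hw (fun t ht => hw2 ⟨t * s, ?_⟩)
      rw [ht, smul_smul]
    · push Not at h
      exact (two y1 hy1 z hz h).symm
  refine ⟨κ y1, fun y v hyv => ?_⟩
  have hy : y ≠ 0 := hyv.ne_zero 0
  have hv := (LI_iff hy).1 hyv
  have p1 := hF.pos x hx y hy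
  have hq : ∀ v, (Rb F x y - (κ y1 * F x y ^ 3) • Hs (F x) (smF hF hx) y hy) v v = 0 := by
    apply quad_zero
    refine (off y).trans_le (measure_mono ?_)
    rintro z ⟨hz, hz2⟩
    have hz3 : ∀ s : ℝ, z ≠ s • y := fun s hs => hz2 ⟨s, hs⟩
    have h1 := K_swap hF hsec hx hy hz3
    rw [hκ z hz y (indep_symm hy hz3).2, hconst z hz, K_eq hF hx hy] at h1
    have p2 := Hpos hF hx hy hz3
    rw [div_eq_iff (by positivity)] at h1
    simp only [Set.mem_setOf_eq, LinearMap.sub_apply, LinearMap.smul_apply, smul_eq_mul, Hs_apply]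
    rw [h1]; ring
  have h1 := hq v
  simp only [LinearMap.sub_apply, LinearMap.smul_apply, smul_eq_mul, Hs_apply] at h1
  have p2 := Hpos hF hx hy hv
  rw [K_eq hF hx hy, div_eq_iff (by positivity)]
  linarith

end Positive

end Proof

/-- For a Finsler metric of sectional flag curvature in dimension ≥ 3:
if the polar directions at `x` have positive Lebesgue measure then the flag curvature
is isotropic at `x`; if they have measure zero then `F(x,·)` is a Randers norm. -/
theorem polar_measure_dichotomy (n : ℕ) (hn : 3 ≤ n)
    (U : Set (E n)) (hU : IsOpen U) (F : E n → E n → ℝ)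
    (hF : IsFinsler n U F) (hsec : SectionalFlagCurv n U F)
    (x : E n) (hx : x ∈ U) :
    (0 < volume {y : E n | y ≠ 0 ∧ IsPolarDir n F x y} → IsotropicAt n F x) ∧
    (volume {y : E n | y ≠ 0 ∧ IsPolarDir n F x y} = 0 →
      ∃ (a : Matrix (Fin n) (Fin n) ℝ) (b : E n), a.IsSymm ∧ a.PosDef ∧
        (∑ i, ∑ j, a⁻¹ i j * b i * b j < 1) ∧
        ∀ y : E n, y ≠ 0 →
          F x y = Real.sqrt (∑ i, ∑ j, a i j * y i * y j) + ∑ i, b i * y i) := by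
  exact ⟨positive_case hF hsec hn hx, null_case hF hU hsec hn hx⟩

end Paper
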